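/- arXiv:1010.2989 — 10 statements merged into one kernel-verified Lean document; each statement's English description precedes it below -/
import Mathlib

section
/- If G is a finite connected simple graph that admits an interval total coloring, then W_τ(G) ≤ 2·|V(G)| − 1, i.e., every interval total t-coloring of G satisfies t ≤ 2·|V(G)| − 1. -/
/-- `IsIntervalTotalColoring G t cv ce` : the pair of colorings `cv` (on vertices) and
`ce` (on edges) is an interval total `t`-coloring of the simple graph `G`:
it is a proper total coloring with colors in `{1,…,t}`, every color in `{1,…,t}` is used
on some vertex or edge, and for every vertex `v` the set consisting of the color of `v`
together with the colors of the edges incident to `v` is a set of `d_G(v) + 1`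
consecutive integers. -/
def IsIntervalTotalColoring {V : Type*} (G : SimpleGraph V) (t : ℕ)
    (cv : V → ℕ) (ce : Sym2 V → ℕ) : Prop :=
  (∀ u v, G.Adj u v → cv u ≠ cv v) ∧
  (∀ e₁ ∈ G.edgeSet, ∀ e₂ ∈ G.edgeSet, e₁ ≠ e₂ → ∀ v, v ∈ e₁ → v ∈ e₂ → ce e₁ ≠ ce e₂) ∧
  (∀ v, ∀ e ∈ G.edgeSet, v ∈ e → cv v ≠ ce e) ∧
  (∀ v, cv v ∈ Set.Icc 1 t) ∧
  (∀ e ∈ G.edgeSet, ce e ∈ Set.Icc 1 t) ∧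
  (∀ i ∈ Set.Icc 1 t, (∃ v, cv v = i) ∨ ∃ e ∈ G.edgeSet, ce e = i) ∧
  (∀ v, ∃ a, {cv v} ∪ ce '' {e ∈ G.edgeSet | v ∈ e} =
      Set.Icc a (a + (G.neighborSet v).ncard))

/-- Colors strictly above `x` up to `y` are covered by distinct neighbours. -/
theorem itc_card_step {U : Type*} [Fintype U] [DecidableEq U] (H : SimpleGraph U)
    (c : U → U → ℕ)
    (hint : ∀ u v w s, H.Adj u v → H.Adj u w → c u v ≤ s → s ≤ c u w →
      ∃ y, H.Adj u y ∧ c u y = s)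
    (u p q : U) (hp : H.Adj u p) (hq : H.Adj u q) :
    ∃ F : Finset U, (∀ w, w ∈ F ↔ H.Adj u w ∧ c u p < c u w ∧ c u w ≤ c u q) ∧
      c u q ≤ c u p + F.card := by
  classical
  refine ⟨Finset.univ.filter (fun w => H.Adj u w ∧ c u p < c u w ∧ c u w ≤ c u q),
    by simp, ?_⟩
  have hsub : Finset.Ioc (c u p) (c u q) ⊆
      (Finset.univ.filter (fun w => H.Adj u w ∧ c u p < c u w ∧ c u w ≤ c u q)).image (c u) := by
    intro s hs
    rw [Finset.mem_Ioc] at hs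
    obtain ⟨y, hy, rfl⟩ := hint u p q s hp hq hs.1.le hs.2
    exact Finset.mem_image_of_mem _ (by simp [hy, hs])
  have h1 := (Finset.card_le_card hsub).trans Finset.card_image_le
  rw [Nat.card_Ioc] at h1
  omega

/-- Inductive construction of a large set of vertices along a greedy geodesic. -/
theorem itc_exists_set {U : Type*} [Fintype U] [DecidableEq U] (H : SimpleGraph U)
    (c : U → U → ℕ) (hsymm : ∀ u v, c u v = c v u)
    (hinj : ∀ u v w, H.Adj u v → H.Adj u w → c u v = c u w → v = w)
    (hint : ∀ u v w s, H.Adj u v → H.Adj u w → c u v ≤ s → s ≤ c u w →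
      ∃ y, H.Adj u y ∧ c u y = s)
    (d : U → ℕ) (hd : ∀ u v, H.Adj u v → d u = d v + 1 ∨ d v = d u + 1)
    (hdec : ∀ u, 0 < d u → ∃ v, H.Adj u v ∧ d v + 1 = d u)
    (t : ℕ) (hz : ∀ u, d u = 0 → ∃ q, H.Adj u q ∧ c u q = t) (m : ℕ) :
    ∀ u p, d u = m → H.Adj u p → ∃ S : Finset U, t ≤ c u p + S.card ∧ u ∉ S ∧
      ∀ w ∈ S, d w ≤ m + 1 ∧ (d w = m + 1 → H.Adj u w ∧ c u p < c u w) := by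
  classical
  induction m with
  | zero =>
    intro u p hu hp
    obtain ⟨q, hq, hqt⟩ := hz u hu
    obtain ⟨F, hF, hcard⟩ := itc_card_step H c hint u p q hp hq
    refine ⟨F, by omega, fun h => H.irrefl ((hF u).1 h).1, fun w hw => ?_⟩
    have := (hF w).1 hw
    have h2 := hd u w this.1
    exact ⟨by omega, fun _ => ⟨this.1, this.2.1⟩⟩
  | succ m ih =>
    intro u p hu hp
    -- greedy choice of the next vertex
    have hne : (Finset.univ.filter (fun v => H.Adj u v ∧ d v = m) : Finset U).Nonempty := by
      obtain ⟨v, hv, hv'⟩ := hdec u (by omega)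
      exact ⟨v, by simp [hv]; omega⟩
    obtain ⟨q, hq, hmin⟩ := Finset.exists_min_image _ (c u) hne
    simp only [Finset.mem_filter, Finset.mem_univ, true_and] at hq hmin
    obtain ⟨F, hF, hcard⟩ := itc_card_step H c hint u p q hp hq.1
    obtain ⟨S, hS, hqS, hSw⟩ := ih q u hq.2 hq.1.symm
    have hFd : ∀ w ∈ F, d w = m + 2 ∨ w = q := by
      intro w hw
      have h1 := (hF w).1 hw
      rcases hd u w h1.1 with h2 | h2
      · right
        have h3 := hmin w ⟨h1.1, by omega⟩
        exact hinj u w q h1.1 hq.1 (by omega)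
      · left; omega
    have hdisj : Disjoint F S := by
      rw [Finset.disjoint_left]
      intro w hw hwS
      rcases hFd w hw with h | h
      · have := (hSw w hwS).1
        omega
      · exact hqS (h ▸ hwS)
    have hs := hsymm u q
    refine ⟨F ∪ S, ?_, ?_, ?_⟩
    · rw [Finset.card_union_of_disjoint hdisj]
      omega
    · intro h
      rcases Finset.mem_union.1 h with h | h
      · exact H.irrefl ((hF u).1 h).1
      · have := ((hSw u h).2 hu).2
        omega
    · intro w hw
      rcases Finset.mem_union.1 hw with h | h
      · have h1 := (hF w).1 h
        have h2 := hd u w h1.1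
        exact ⟨by omega, fun _ => ⟨h1.1, h1.2.1⟩⟩
      · have := (hSw w h).1
        exact ⟨by omega, fun _ => by omega⟩

/-- A bipartite connected graph with an interval edge coloring has at most `|U| - 1` colors. -/
theorem itc_bipartite_bound {U : Type*} [Fintype U] (H : SimpleGraph U)
    (hconn : H.Connected) (col : H.Coloring Bool)
    (c : U → U → ℕ) (hsymm : ∀ u v, c u v = c v u)
    (hinj : ∀ u v w, H.Adj u v → H.Adj u w → c u v = c u w → v = w)
    (hint : ∀ u v w s, H.Adj u v → H.Adj u w → c u v ≤ s → s ≤ c u w →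
      ∃ y, H.Adj u y ∧ c u y = s)
    (t : ℕ) (z q : U) (hzq : H.Adj z q) (hzt : c z q = t)
    (a b : U) (hab : H.Adj a b) (hab1 : c a b = 1) :
    t + 1 ≤ Fintype.card U := by
  classical
  have hd : ∀ u v, H.Adj u v →
      H.dist u z = H.dist v z + 1 ∨ H.dist v z = H.dist u z + 1 := by
    intro u v huv
    have h1 : H.dist u z ≤ H.dist u v + H.dist v z := hconn.dist_triangle
    have h2 : H.dist v z ≤ H.dist v u + H.dist u z := hconn.dist_triangle
    rw [SimpleGraph.dist_eq_one_iff_adj.2 huv] at h1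
    rw [SimpleGraph.dist_eq_one_iff_adj.2 huv.symm] at h2
    have h3 : H.dist u z ≠ H.dist v z := by
      intro h
      obtain ⟨w1, hw1⟩ := hconn.exists_walk_length_eq_dist u z
      obtain ⟨w2, hw2⟩ := hconn.exists_walk_length_eq_dist v z
      have e1 := col.even_length_iff_congr w1
      have e2 := col.even_length_iff_congr w2
      have e3 := col.valid huv
      rw [hw1, h, ← hw2, e2] at e1
      revert e1 e3
      cases col u <;> cases col v <;> cases col z <;> simp
    omega
  have hdec : ∀ u, 0 < H.dist u z → ∃ v, H.Adj u v ∧ H.dist v z + 1 = H.dist u z := by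
    intro u hu
    obtain ⟨w, hw⟩ := hconn.exists_walk_length_eq_dist u z
    cases w with
    | nil => simp at hu
    | cons hadj w =>
      refine ⟨_, hadj, ?_⟩
      have h1 := SimpleGraph.dist_le w
      have h2 := hd _ _ hadj
      simp only [SimpleGraph.Walk.length_cons] at hw
      omega
  have hz : ∀ u, H.dist u z = 0 → ∃ q, H.Adj u q ∧ c u q = t := by
    intro u hu
    have : u = z := hconn.dist_eq_zero_iff.1 hu
    exact this ▸ ⟨q, hzq, hzt⟩
  have key : ∀ a b, H.Adj a b → c a b = 1 → H.dist b z = H.dist a z + 1 →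
      t + 1 ≤ Fintype.card U := by
    intro a b hab h1 hdist
    obtain ⟨S, hS, haS, hSw⟩ := itc_exists_set H c hsymm hinj hint (fun u => H.dist u z) hd hdec
      t hz _ a b rfl hab
    have hbS : b ∉ S := fun h => lt_irrefl _ ((hSw b h).2 hdist).2
    have h3 : (insert a (insert b S)).card = S.card + 2 := by
      rw [Finset.card_insert_of_notMem, Finset.card_insert_of_notMem hbS]
      simp [haS, hab.ne]
    have h4 := Finset.card_le_univ (insert a (insert b S))
    omega
  rcases hd a b hab with h | h
  · exact key b a hab.symm (hsymm a b ▸ hab1) h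
  · exact key a b hab hab1 h

/-- The bipartite double of a graph with a loop added at each vertex. -/
def itcDouble {V : Type*} (G : SimpleGraph V) : SimpleGraph (V × Bool) where
  Adj x y := x.2 ≠ y.2 ∧ (x.1 = y.1 ∨ G.Adj x.1 y.1)
  symm := ⟨fun _ _ h => ⟨h.1.symm, h.2.imp Eq.symm SimpleGraph.Adj.symm⟩⟩
  loopless := ⟨fun _ h => h.1 rfl⟩

theorem itcDouble_connected {V : Type*} (G : SimpleGraph V) (hconn : G.Connected) :
    (itcDouble G).Connected := by
  have hflip : ∀ v a b, (itcDouble G).Reachable (v, a) (v, b) := by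
    intro v a b
    by_cases h : a = b
    · rw [h]
    · exact SimpleGraph.Adj.reachable ⟨h, Or.inl rfl⟩
  have hw : ∀ u v, G.Walk u v → ∀ a b, (itcDouble G).Reachable (u, a) (v, b) := by
    intro u v w
    induction w with
    | nil => exact hflip _
    | cons h w ih =>
      intro a b
      have hadj : (itcDouble G).Adj (_, a) (_, !a) := ⟨by simp, Or.inr h⟩
      exact hadj.reachable.trans (ih _ _)
  obtain ⟨v0⟩ := hconn.nonempty
  have : Nonempty (V × Bool) := ⟨(v0, true)⟩
  refine ⟨fun x y => ?_⟩
  obtain ⟨w⟩ := hconn.preconnected x.1 y.1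
  exact hw _ _ w x.2 y.2

/-- If `G` is a finite connected simple graph, then every interval total `t`-coloring of
`G` satisfies `t ≤ 2|V(G)| - 1`; i.e. `W_τ(G) ≤ 2|V(G)| - 1`. -/
theorem W_tau_le_of_connected {V : Type*} [Fintype V] (G : SimpleGraph V)
    (hconn : G.Connected) (t : ℕ) (cv : V → ℕ) (ce : Sym2 V → ℕ)
    (h : IsIntervalTotalColoring G t cv ce) :
    t ≤ 2 * Fintype.card V - 1 := by
  classical
  obtain ⟨-, hee, hve, hv1, he1, hall, hint⟩ := h
  obtain ⟨v0⟩ := hconn.nonempty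
  have hpos : 0 < Fintype.card V := Fintype.card_pos_iff.2 ⟨v0⟩
  rcases Nat.eq_zero_or_pos t with ht | ht
  · omega
  set C : V × Bool → V × Bool → ℕ := fun x y => if x.1 = y.1 then cv x.1 else ce s(x.1, y.1)
    with hC
  -- every color occurs on an edge of the double
  have hocc : ∀ i ∈ Set.Icc 1 t, ∃ x y, (itcDouble G).Adj x y ∧ C x y = i := by
    intro i hi
    rcases hall i hi with ⟨v, hv⟩ | ⟨e, he, hei⟩
    · exact ⟨(v, true), (v, false), ⟨by simp, Or.inl rfl⟩, by simp [hC, hv]⟩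
    · induction e using Sym2.ind with
      | _ u v =>
        have hadj : G.Adj u v := he
        exact ⟨(u, true), (v, false), ⟨by simp, Or.inr hadj⟩, by simp [hC, hadj.ne, hei]⟩
  have hmem : ∀ x y, (itcDouble G).Adj x y →
      C x y ∈ {cv x.1} ∪ ce '' {e ∈ G.edgeSet | x.1 ∈ e} := by
    rintro ⟨u, a⟩ ⟨v, b⟩ ⟨-, h⟩
    by_cases huv : u = v
    · left; simp [hC, huv]
    · right
      have hadj : G.Adj u v := h.resolve_left huv
      exact ⟨s(u, v), ⟨hadj, by simp⟩, by simp [hC, huv]⟩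
  obtain ⟨z, q, hzq, hzt⟩ := hocc t ⟨ht, le_rfl⟩
  obtain ⟨a, b, hab, hab1⟩ := hocc 1 ⟨le_rfl, ht⟩
  have hfin := itc_bipartite_bound (itcDouble G) (itcDouble_connected G hconn)
    (SimpleGraph.Coloring.mk (fun x => x.2) (fun h => h.1)) C ?_ ?_ ?_ t z q hzq hzt a b hab hab1
  · rw [Fintype.card_prod, Fintype.card_bool] at hfin
    omega
  · rintro ⟨u, a⟩ ⟨v, b⟩
    by_cases huv : u = v
    · simp [hC, huv]
    · simp [hC, huv, Ne.symm huv, Sym2.eq_swap]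
  · rintro ⟨u, a⟩ ⟨v, b⟩ ⟨w, b'⟩ ⟨h1, h2⟩ ⟨h3, h4⟩ heq
    have hbb : b = b' := by
      revert h1 h3
      cases a <;> cases b <;> cases b' <;> simp
    subst hbb
    simp only at h2 h4
    congr 1
    by_cases huv : u = v <;> by_cases huw : u = w
    · exact huv.symm.trans huw
    · have hadj := h4.resolve_left huw
      simp only [hC, if_pos huv, if_neg huw] at heq
      exact absurd heq (hve u s(u, w) hadj (by simp))
    · have hadj := h2.resolve_left huv
      simp only [hC, if_neg huv, if_pos huw] at heq
      exact absurd heq.symm (hve u s(u, v) hadj (by simp))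
    · have hadj := h2.resolve_left huv
      have hadj' := h4.resolve_left huw
      simp only [hC, if_neg huv, if_neg huw] at heq
      by_contra hvw
      exact hee s(u, v) hadj s(u, w) hadj' (fun h => hvw (Sym2.congr_right.1 h)) u
        (by simp) (by simp) heq
  · intro x y w s hy hw hys hsw
    obtain ⟨k, hk⟩ := hint x.1
    have m1 := hmem x y hy
    have m2 := hmem x w hw
    rw [hk] at m1 m2
    have m3 : s ∈ {cv x.1} ∪ ce '' {e ∈ G.edgeSet | x.1 ∈ e} := by
      rw [hk]
      exact ⟨m1.1.trans hys, hsw.trans m2.2⟩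
    obtain ⟨u, a⟩ := x
    rcases m3 with m3 | ⟨e, ⟨he, hue⟩, hes⟩
    · exact ⟨(u, !a), ⟨by simp, Or.inl rfl⟩, by simpa [hC] using (Set.mem_singleton_iff.1 m3).symm⟩
    · obtain ⟨v, rfl⟩ := Sym2.mem_iff_exists.1 hue
      have hadj : G.Adj u v := he
      exact ⟨(v, !a), ⟨by simp, Or.inr hadj⟩, by simpa [hC, hadj.ne] using hes⟩
end

section
/- For every n ≥ 1, the path P_n on n vertices satisfies W_τ(P_n) = 2n − 1: the path P_n has an interval total (2n−1)-coloring, and it has no interval total t-coloring with t > 2n − 1. -/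
open SimpleGraph in
lemma ncard_nbr (n : ℕ) (v : Fin n) : ((pathGraph n).neighborSet v).ncard =
    (if v.val = 0 then 0 else 1) + (if v.val + 1 < n then 1 else 0) := by
  rw [← Set.ncard_image_of_injective _ Fin.val_injective]
  have h : Fin.val '' ((pathGraph n).neighborSet v) =
      {x | x < n ∧ (v.val + 1 = x ∨ x + 1 = v.val)} := by
    ext x
    simp only [Set.mem_image, mem_neighborSet, pathGraph_adj, Set.mem_ofPred_eq]
    constructor
    · rintro ⟨w, hw, rfl⟩
      exact ⟨w.2, hw⟩
    · rintro ⟨hx, hw⟩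
      exact ⟨⟨x, hx⟩, hw, rfl⟩
  rw [h]
  have hv := v.2
  split_ifs with h0 h1 h1
  · have : {x | x < n ∧ (v.val + 1 = x ∨ x + 1 = v.val)} = {v.val + 1} := by
      ext x; simp only [Set.mem_ofPred_eq, Set.mem_singleton_iff]; omega
    rw [this, Set.ncard_singleton]
  · have : {x | x < n ∧ (v.val + 1 = x ∨ x + 1 = v.val)} = ∅ := by
      ext x; simp only [Set.mem_ofPred_eq, Set.mem_empty_iff_false, iff_false]; omega
    rw [this, Set.ncard_empty]
  · have : {x | x < n ∧ (v.val + 1 = x ∨ x + 1 = v.val)} = {v.val - 1, v.val + 1} := by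
      ext x; simp only [Set.mem_ofPred_eq, Set.mem_insert_iff, Set.mem_singleton_iff]; omega
    rw [this, Set.ncard_pair (by omega)]
  · have : {x | x < n ∧ (v.val + 1 = x ∨ x + 1 = v.val)} = {v.val - 1} := by
      ext x; simp only [Set.mem_ofPred_eq, Set.mem_singleton_iff]; omega
    rw [this, Set.ncard_singleton]

def sumColor (n : ℕ) : Sym2 (Fin n) → ℕ :=
  Sym2.lift ⟨fun a b => a.val + b.val + 1, fun a b => by simp only; omega⟩

lemma sumColor_mk (n : ℕ) (a b : Fin n) : sumColor n s(a, b) = a.val + b.val + 1 := rfl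

open SimpleGraph in
lemma exists_col (n : ℕ) (hn : 1 ≤ n) : IsIntervalTotalColoring (pathGraph n) (2 * n - 1)
    (fun v => 2 * v.val + 1) (sumColor n) := by
  refine ⟨?_, ?_, ?_, ?_, ?_, ?_, ?_⟩
  · intro u v h
    rw [pathGraph_adj] at h
    simp only
    omega
  · intro e₁ h₁ e₂ h₂ hne v hv₁ hv₂
    obtain ⟨a, rfl⟩ := hv₁
    obtain ⟨b, rfl⟩ := hv₂
    rw [sumColor_mk, sumColor_mk]
    intro h
    have : a = b := Fin.ext (by omega)
    exact hne (by rw [this])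
  · intro v e he hv
    obtain ⟨a, rfl⟩ := hv
    rw [mem_edgeSet, pathGraph_adj] at he
    rw [sumColor_mk]
    simp only
    omega
  · intro v
    have := v.2
    simp only [Set.mem_Icc]
    omega
  · intro e he
    induction e with | _ a b
    rw [mem_edgeSet, pathGraph_adj] at he
    rw [sumColor_mk, Set.mem_Icc]
    omega
  · intro i hi
    rw [Set.mem_Icc] at hi
    rcases Nat.even_or_odd' i with ⟨k, hk | hk⟩
    · right
      refine ⟨s(⟨k - 1, by omega⟩, ⟨k, by omega⟩), ?_, ?_⟩
      · rw [mem_edgeSet, pathGraph_adj]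
        simp only
        omega
      · rw [sumColor_mk]
        simp only
        omega
    · left
      exact ⟨⟨k, by omega⟩, hk.symm⟩
  · intro v
    rw [ncard_nbr]
    refine ⟨if v.val = 0 then 1 else 2 * v.val, ?_⟩
    have hv := v.2
    ext x
    simp only [Set.mem_union, Set.mem_singleton_iff, Set.mem_image, Set.mem_ofPred_eq, Set.mem_Icc]
    constructor
    · rintro (rfl | ⟨e, ⟨he, a, rfl⟩, rfl⟩)
      · split_ifs <;> omega
      · have ha := a.2
        rw [mem_edgeSet, pathGraph_adj] at he
        rw [sumColor_mk]
        split_ifs <;> omega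
    · intro hx
      by_cases h1 : x = 2 * v.val + 1
      · exact Or.inl h1
      right
      by_cases h2 : x = 2 * v.val + 2
      · have : v.val + 1 < n := by
          by_contra hc
          rw [if_neg hc] at hx
          split_ifs at hx <;> omega
        refine ⟨s(v, ⟨v.val + 1, this⟩), ⟨?_, Sym2.mem_mk_left _ _⟩, ?_⟩
        · rw [mem_edgeSet, pathGraph_adj]
          simp
        · rw [sumColor_mk]
          simp only
          omega
      · have : v.val ≠ 0 ∧ x = 2 * v.val := by
          split_ifs at hx <;> omega
        refine ⟨s(v, ⟨v.val - 1, by omega⟩), ⟨?_, Sym2.mem_mk_left _ _⟩, ?_⟩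
        · rw [mem_edgeSet, pathGraph_adj]
          simp only
          omega
        · rw [sumColor_mk]
          simp only
          omega

open SimpleGraph in
lemma upper (n t : ℕ) (hn : 1 ≤ n) (cv : Fin n → ℕ) (ce : Sym2 (Fin n) → ℕ)
    (h : IsIntervalTotalColoring (pathGraph n) t cv ce) : t ≤ 2 * n - 1 := by
  obtain ⟨-, -, -, -, -, h, -⟩ := h
  have hsub : Finset.Icc 1 t ⊆ Finset.univ.image cv ∪
      (Finset.univ : Finset (Fin (n - 1))).image
        (fun i => ce s(⟨i.val, by omega⟩, ⟨i.val + 1, by omega⟩)) := by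
    intro i hi
    rw [Finset.mem_union, Finset.mem_image, Finset.mem_image]
    rcases h i (by simpa using hi) with ⟨v, hv⟩ | ⟨e, he, hei⟩
    · exact Or.inl ⟨v, Finset.mem_univ _, hv⟩
    · right
      induction e with | _ a b
      rw [mem_edgeSet, pathGraph_adj] at he
      rcases he with he | he
      · refine ⟨⟨a.val, by omega⟩, Finset.mem_univ _, ?_⟩
        have hb : b = ⟨a.val + 1, by omega⟩ := Fin.ext he.symm
        rw [← hei]
        exact congrArg (fun z => ce s(a, z)) hb.symm
      · refine ⟨⟨b.val, by omega⟩, Finset.mem_univ _, ?_⟩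
        have ha : a = ⟨b.val + 1, by omega⟩ := Fin.ext he.symm
        rw [← hei, Sym2.eq_swap]
        exact congrArg (fun z => ce s(z, b)) ha.symm
  have h1 := (Finset.card_le_card hsub).trans (Finset.card_union_le _ _)
  have h2 := Finset.card_image_le (s := Finset.univ) (f := cv)
  have h3 := Finset.card_image_le (s := (Finset.univ : Finset (Fin (n - 1))))
    (f := fun i => ce s(⟨i.val, by omega⟩, ⟨i.val + 1, by omega⟩))
  simp only [Nat.card_Icc, Finset.card_univ, Fintype.card_fin] at h1 h2 h3
  omega


/-- For every `n ≥ 1` the path `Pₙ` on `n` vertices satisfies `W_τ(Pₙ) = 2n - 1` :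
it has an interval total `(2n-1)`-coloring, and every interval total `t`-coloring of it
satisfies `t ≤ 2n - 1`. -/
theorem W_tau_pathGraph (n : ℕ) (hn : 1 ≤ n) :
    (∃ (cv : Fin n → ℕ) (ce : Sym2 (Fin n) → ℕ),
      IsIntervalTotalColoring (SimpleGraph.pathGraph n) (2 * n - 1) cv ce) ∧
    (∀ (t : ℕ) (cv : Fin n → ℕ) (ce : Sym2 (Fin n) → ℕ),
      IsIntervalTotalColoring (SimpleGraph.pathGraph n) t cv ce → t ≤ 2 * n - 1) := by
  exact ⟨⟨_, _, exists_col n hn⟩, fun t cv ce h => upper n t hn cv ce h⟩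
end

section
/- If G is a finite connected r-regular simple graph with |V(G)| ≥ 2r + 2 that admits an interval total coloring, then W_τ(G) ≤ 2·|V(G)| − 3, i.e., every interval total t-coloring of G satisfies t ≤ 2·|V(G)| − 3. -/
/-- Combinatorial core. -/
lemma core_bound {V : Type*} [Fintype V] [DecidableEq V] (r t : ℕ) (N : V → Finset V) (a : V → ℕ)
    (hself : ∀ v, v ∈ N v) (hsymm : ∀ v y, y ∈ N v → v ∈ N y)
    (hNc : ∀ v, (N v).card = r + 1)
    (hclose : ∀ v, ∀ y ∈ N v, a y ≤ a v + r)
    (hN : ∀ v m, a v ≤ m + 1 → a v + r ≤ m + ((N v).filter (fun y => m < a y + r)).card)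
    (hconn : ∀ S : Finset V, S.Nonempty → (∃ z, z ∉ S) → ∃ v ∈ S, ∃ w ∉ S, w ∈ N v)
    (v0 : V) (hv0 : a v0 = 1) (ht : ∀ v, a v + r ≤ t) (v1 : V) (hv1 : a v1 + r = t)
    (hcard : 2 * r + 2 ≤ Fintype.card V) : t + 3 ≤ 2 * Fintype.card V := by
  classical
  by_cases hsmall : t ≤ 3 * r + 1
  · omega
  push Not at hsmall
  let S : ℕ → Finset V := fun m => Finset.univ.filter (fun v => a v + r ≤ m)
  let B : ℕ → ℕ := fun m => ((S m).biUnion N).sup (fun y => a y + r)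
  have hS : ∀ m v, v ∈ S m ↔ a v + r ≤ m := by intro m v; simp [S]
  have hB1 : ∀ m v y, v ∈ S m → y ∈ N v → a y + r ≤ B m := by
    intro m v y hv hy
    exact Finset.le_sup (f := fun y => a y + r) (Finset.mem_biUnion.2 ⟨v, hv, hy⟩)
  have hB2 : ∀ m, B m ≤ m + r := by
    intro m
    apply Finset.sup_le
    intro y hy
    obtain ⟨v, hv, hy⟩ := Finset.mem_biUnion.1 hy
    have := hclose v y hy
    have := (hS m v).1 hv
    omega
  have hB3 : ∀ m, (∃ w, a w + r = m) → ∃ w, a w + r = B m := by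
    rintro m ⟨w, hw⟩
    have hne : ((S m).biUnion N).Nonempty :=
      ⟨w, Finset.mem_biUnion.2 ⟨w, (hS m w).2 hw.le, hself w⟩⟩
    obtain ⟨y, _, hy⟩ := Finset.exists_mem_eq_sup _ hne (fun y => a y + r)
    exact ⟨y, hy.symm⟩
  have hB4 : ∀ m, (∃ w, a w + r = m) → m < t → m < B m := by
    rintro m ⟨w, hw⟩ hmt
    obtain ⟨v, hv, y, hy, hyv⟩ := hconn (S m) ⟨w, (hS m w).2 hw.le⟩
      ⟨v1, fun h => by have := (hS m v1).1 h; omega⟩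
    have := hB1 m v y hv hyv
    rw [hS] at hy
    omega
  have hstep : ∀ p, (∃ w, a w + r = p) → B p + (S p).card ≤ p + (S (B (B p))).card := by
    intro p hp
    obtain ⟨w, hw⟩ := hB3 p hp
    have h1 := hB2 p
    have h2 := hN w p (by omega)
    have h3 : (S p) ∪ ((N w).filter (fun y => p < a y + r)) ⊆ S (B (B p)) := by
      intro y hy
      rcases Finset.mem_union.1 hy with hy | hy
      · have e1 := hB1 p y y hy (hself y)
        exact (hS _ _).2 (hB1 (B p) y y ((hS _ _).2 e1) (hself y))
      · exact (hS _ _).2 (hB1 (B p) w y ((hS _ _).2 hw.le) (Finset.mem_filter.1 hy).1)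
    have h4 : Disjoint (S p) ((N w).filter (fun y => p < a y + r)) := by
      rw [Finset.disjoint_left]
      intro y hy hy'
      have := (hS _ _).1 hy
      have := (Finset.mem_filter.1 hy').2
      omega
    have h5 := Finset.card_le_card h3
    rw [Finset.card_union_of_disjoint h4] at h5
    omega
  let m : ℕ → ℕ := fun i => B^[i] (r + 1)
  have hm0 : m 0 = r + 1 := rfl
  have hms : ∀ i, m (i + 1) = B (m i) := fun i => Function.iterate_succ_apply' B i (r + 1)
  have hatt : ∀ i, ∃ w, a w + r = m i := by
    intro i
    induction i with
    | zero => exact ⟨v0, by omega⟩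
    | succ i ih => rw [hms]; exact hB3 _ ih
  have hmt : ∀ i, m i ≤ t := by
    intro i
    obtain ⟨w, hw⟩ := hatt i
    have := ht w
    omega
  have hex : ∃ k, t ≤ m k := by
    by_contra hcon
    push Not at hcon
    have : ∀ i, i ≤ m i := by
      intro i
      induction i with
      | zero => omega
      | succ i ih =>
        have := hB4 (m i) (hatt i) (hcon i)
        rw [hms]; omega
    have h1 := this t
    have h2 := hcon t
    omega
  let k := Nat.find hex
  have hk : t ≤ m k := Nat.find_spec hex
  have hlt : ∀ i, i < k → m i < t := fun i hi => not_le.1 (Nat.find_min hex hi)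
  have hm1 : m 1 ≤ 2 * r + 1 := by
    have := hB2 (m 0); rw [← hms] at this; simp only [zero_add] at this; omega
  have hm2 : m 2 ≤ 3 * r + 1 := by
    have := hB2 (m 1); rw [← hms] at this; simp only [Nat.reduceAdd] at this; omega
  have hk3 : 3 ≤ k := by
    by_contra hcon
    have hc : k = 0 ∨ k = 1 ∨ k = 2 := by omega
    rcases hc with h | h | h <;> rw [h] at hk <;> omega
  have hs1 : r + 1 ≤ (S (m 1)).card := by
    rw [← hNc v0]
    apply Finset.card_le_card
    intro y hy
    rw [hS, hms 0]
    exact hB1 (m 0) v0 y ((hS _ _).2 (by omega)) hy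
  have hs2 : r + 2 ≤ (S (m 2)).card := by
    have h12 : m 1 < m 2 := by rw [hms 1]; exact hB4 _ (hatt 1) (hlt 1 (by omega))
    have : S (m 1) ⊂ S (m 2) := by
      rw [Finset.ssubset_iff_of_subset]
      · obtain ⟨w, hw⟩ := hatt 2
        exact ⟨w, (hS _ _).2 hw.le, fun h => by have := (hS _ _).1 h; omega⟩
      · intro y hy
        rw [hS] at hy ⊢
        omega
    have := Finset.card_lt_card this
    omega
  have hP : ∀ i, m (i + 1) + 2 ≤ (S (m (i + 2))).card + (S (m (i + 1))).card := by
    intro i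
    induction i with
    | zero => simp only [zero_add]; omega
    | succ i ih =>
      have := hstep (m (i + 1)) (hatt _)
      rw [← hms, ← hms] at this
      simp only [add_assoc, Nat.reduceAdd] at this ⊢
      omega
  obtain ⟨j, hj⟩ : ∃ j, k = j + 3 := ⟨k - 3, by omega⟩
  rw [hj] at hk
  have e1 := hP j
  have e2 := hB2 (m (j + 1))
  rw [← hms] at e2
  have e3 := hstep (m (j + 2)) (hatt _)
  rw [← hms, ← hms] at e3
  simp only [add_assoc, Nat.reduceAdd] at e1 e2 e3
  have e4 : (S (m (j + 4))).card ≤ Fintype.card V := Finset.card_le_univ _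
  have e5 : (S (m (j + 1))).card + (r + 1) ≤ Fintype.card V := by
    rw [← hNc v1, ← Finset.card_union_of_disjoint]
    · exact Finset.card_le_univ _
    · rw [Finset.disjoint_left]
      intro y hy hy'
      have h1 := hB1 _ y v1 hy (hsymm _ _ hy')
      rw [← hms] at h1
      have h2 := hlt (j + 2) (by omega)
      simp only [add_assoc, Nat.reduceAdd] at h1
      omega
  omega

/-- If `G` is a finite connected `r`-regular simple graph with `|V(G)| ≥ 2r + 2`, then
every interval total `t`-coloring of `G` satisfies `t ≤ 2|V(G)| - 3`;
i.e. `W_τ(G) ≤ 2|V(G)| - 3`. -/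
theorem W_tau_le_of_regular {V : Type*} [Fintype V] (G : SimpleGraph V)
    (hconn : G.Connected) (r : ℕ) (hreg : ∀ v, (G.neighborSet v).ncard = r)
    (hcard : 2 * r + 2 ≤ Fintype.card V)
    (t : ℕ) (cv : V → ℕ) (ce : Sym2 V → ℕ)
    (h : IsIntervalTotalColoring G t cv ce) :
    t ≤ 2 * Fintype.card V - 3 := by
  classical
  obtain ⟨-, hee, hve, hcv, hce, hsurj, hint⟩ := h
  simp only [hreg] at hint
  choose a ha using hint
  have hne : Nonempty V := hconn.nonempty
  let N : V → Finset V := fun v => Finset.univ.filter (fun y => y = v ∨ G.Adj v y)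
  have hNm : ∀ v y, y ∈ N v ↔ y = v ∨ G.Adj v y := by intro v y; simp [N]
  let col : V → V → ℕ := fun v y => if y = v then cv v else ce s(v, y)
  have hcI : ∀ v, a v ≤ cv v ∧ cv v ≤ a v + r := by
    intro v
    have : cv v ∈ Set.Icc (a v) (a v + r) := by rw [← ha]; simp
    exact this
  have heI : ∀ v, ∀ e ∈ G.edgeSet, v ∈ e → a v ≤ ce e ∧ ce e ≤ a v + r := by
    intro v e he hv
    have : ce e ∈ Set.Icc (a v) (a v + r) := by
      rw [← ha]; exact Or.inr ⟨e, ⟨he, hv⟩, rfl⟩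
    exact this
  have hcolv : ∀ v, ∀ y ∈ N v, a v ≤ col v y ∧ col v y ≤ a v + r := by
    intro v y hy
    by_cases hyv : y = v
    · simp only [col, hyv, if_true]; exact hcI v
    · simp only [col, hyv, if_false]
      exact heI v _ (((hNm v y).1 hy).resolve_left hyv) (by simp)
  have hcoly : ∀ v, ∀ y ∈ N v, a y ≤ col v y ∧ col v y ≤ a y + r := by
    intro v y hy
    by_cases hyv : y = v
    · subst hyv; simp only [col, if_true]; exact hcI y
    · simp only [col, hyv, if_false]
      exact heI y _ (((hNm v y).1 hy).resolve_left hyv) (by simp)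
  have hcolsurj : ∀ v c, a v ≤ c → c ≤ a v + r → ∃ y ∈ N v, col v y = c := by
    intro v c h1 h2
    have : c ∈ Set.Icc (a v) (a v + r) := ⟨h1, h2⟩
    rw [← ha] at this
    rcases this with h | ⟨e, ⟨he, hv⟩, hc⟩
    · exact ⟨v, (hNm v v).2 (Or.inl rfl), by simpa [col] using h.symm⟩
    · obtain ⟨y, rfl⟩ := Sym2.mem_iff_exists.1 hv
      have hadj : G.Adj v y := he
      exact ⟨y, (hNm v y).2 (Or.inr hadj), by simp [col, hadj.ne', hc]⟩
  have hNc : ∀ v, (N v).card = r + 1 := by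
    intro v
    have h1 : N v = insert v (G.neighborSet v).toFinset := by
      ext y; simp [hNm]
    rw [h1, Finset.card_insert_of_notMem (by simp), ← hreg v, Set.ncard_eq_toFinset_card']
  have ha1 : ∀ v, 1 ≤ a v := by
    intro v
    obtain ⟨y, hy, hc⟩ := hcolsurj v (a v) le_rfl (by omega)
    by_cases hyv : y = v
    · simp only [col, hyv, if_true] at hc; have := (hcv v).1; omega
    · simp only [col, hyv, if_false] at hc
      have := (hce s(v, y) (((hNm v y).1 hy).resolve_left hyv)).1; omega
  have hat : ∀ v, a v + r ≤ t := by
    intro v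
    obtain ⟨y, hy, hc⟩ := hcolsurj v (a v + r) (by omega) le_rfl
    by_cases hyv : y = v
    · simp only [col, hyv, if_true] at hc; have := (hcv v).2; omega
    · simp only [col, hyv, if_false] at hc
      have := (hce s(v, y) (((hNm v y).1 hy).resolve_left hyv)).2; omega
  have hused : ∀ i, 1 ≤ i → i ≤ t → ∃ v, a v ≤ i ∧ i ≤ a v + r := by
    intro i h1 h2
    rcases hsurj i ⟨h1, h2⟩ with ⟨v, rfl⟩ | ⟨e, he, rfl⟩
    · exact ⟨v, hcI v⟩
    · induction e using Sym2.ind with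
      | _ x y => exact ⟨x, heI x _ he (by simp)⟩
  have ht1 : 1 ≤ t := by
    obtain ⟨v⟩ := hne
    have := ha1 v; have := hat v; omega
  obtain ⟨v0, hv0, -⟩ := hused 1 le_rfl ht1
  obtain ⟨v1, -, hv1⟩ := hused t ht1 le_rfl
  have key := core_bound r t N a (fun v => (hNm v v).2 (Or.inl rfl)) ?_ hNc ?_ ?_ ?_ v0
    (le_antisymm hv0 (ha1 v0)) hat v1 (le_antisymm (hat v1) hv1) hcard
  · omega
  · intro v y hy
    rw [hNm] at hy ⊢
    exact hy.imp Eq.symm (fun h => SimpleGraph.Adj.symm h)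
  · intro v y hy
    exact (hcoly v y hy).1.trans (hcolv v y hy).2
  · intro v m hm
    have hsub : Finset.Ioc m (a v + r) ⊆ ((N v).filter (fun y => m < a y + r)).image (col v) := by
      intro c hc
      rw [Finset.mem_Ioc] at hc
      obtain ⟨y, hy, hyc⟩ := hcolsurj v c (by omega) hc.2
      have := (hcoly v y hy).2
      exact Finset.mem_image.2 ⟨y, Finset.mem_filter.2 ⟨hy, by omega⟩, hyc⟩
    have h1 := (Finset.card_le_card hsub).trans Finset.card_image_le
    rw [Nat.card_Ioc] at h1
    omega
  · rintro T ⟨x, hx⟩ ⟨z, hz⟩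
    obtain ⟨p⟩ := hconn.preconnected x z
    obtain ⟨d, _, hd1, hd2⟩ := p.exists_boundary_dart (T : Set V) hx hz
    exact ⟨d.fst, hd1, d.snd, hd2, (hNm _ _).2 (Or.inr d.adj)⟩
end

section
/- If G is a finite connected simple graph that admits an interval total coloring, then W_τ(G) ≤ 1 + max_{P ∈ 𝐏} Σ_{v ∈ V(P)} d_G(v), where 𝐏 is the set of all shortest paths in G (paths between two vertices whose length equals the graph distance between their endpoints) and the sum is over all vertices lying on the path P. -/
/-- Along a walk, colors seen at the two ends differ by at most the degree sum. -/
theorem walk_color_bound {V : Type*} (G : SimpleGraph V) (cv : V → ℕ) (ce : Sym2 V → ℕ)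
    (h : ∀ v, ∃ a, {cv v} ∪ ce '' {e ∈ G.edgeSet | v ∈ e} =
      Set.Icc a (a + (G.neighborSet v).ncard))
    {u v : V} (p : G.Walk u v) : ∀ c c' : ℕ,
      c ∈ ({cv u} ∪ ce '' {e ∈ G.edgeSet | u ∈ e} : Set ℕ) →
      c' ∈ ({cv v} ∪ ce '' {e ∈ G.edgeSet | v ∈ e} : Set ℕ) →
      c' ≤ c + (p.support.map fun w => (G.neighborSet w).ncard).sum := by
  induction p with
  | nil =>
    intro c c' hc hc'
    obtain ⟨a, ha⟩ := h _
    rw [ha, Set.mem_Icc] at hc hc'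
    simp only [SimpleGraph.Walk.support_nil, List.map_cons, List.map_nil, List.sum_cons,
      List.sum_nil]
    omega
  | @cons u w v hadj p ih =>
    intro c c' hc hc'
    have h1 : ce s(u, w) ∈ ({cv u} ∪ ce '' {e ∈ G.edgeSet | u ∈ e} : Set ℕ) :=
      Or.inr ⟨s(u, w), ⟨hadj, by simp⟩, rfl⟩
    have h2 : ce s(u, w) ∈ ({cv w} ∪ ce '' {e ∈ G.edgeSet | w ∈ e} : Set ℕ) :=
      Or.inr ⟨s(u, w), ⟨hadj, by simp⟩, rfl⟩
    have h3 := ih _ _ h2 hc'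
    obtain ⟨a, ha⟩ := h u
    rw [ha, Set.mem_Icc] at hc h1
    simp only [SimpleGraph.Walk.support_cons, List.map_cons, List.sum_cons]
    omega

/-- If `G` is a finite connected simple graph, then every interval total `t`-coloring of
`G` satisfies `t ≤ 1 + max_{P ∈ 𝐏} Σ_{v ∈ V(P)} d_G(v)`, where `𝐏` is the set of all
shortest paths of `G`; i.e. there is a path `p` whose length equals the distance between
its endpoints such that `t ≤ 1 + Σ_{v ∈ V(p)} d_G(v)`. -/
theorem W_tau_le_shortestPath_degreeSum {V : Type*} [Fintype V] (G : SimpleGraph V)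
    (hconn : G.Connected) (t : ℕ) (cv : V → ℕ) (ce : Sym2 V → ℕ)
    (h : IsIntervalTotalColoring G t cv ce) :
    ∃ (u v : V) (p : G.Walk u v), p.IsPath ∧ p.length = G.dist u v ∧
      t ≤ 1 + (p.support.map fun w => (G.neighborSet w).ncard).sum := by
  obtain ⟨-, -, -, hcv, -, hall, hint⟩ := h
  have key : ∀ i ∈ Set.Icc 1 t,
      ∃ v, i ∈ ({cv v} ∪ ce '' {e ∈ G.edgeSet | v ∈ e} : Set ℕ) := by
    intro i hi
    rcases hall i hi with ⟨v, hv⟩ | ⟨e, he, hei⟩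
    · exact ⟨v, Or.inl hv.symm⟩
    · induction e with
      | h x y => exact ⟨x, Or.inr ⟨s(x, y), ⟨he, by simp⟩, hei⟩⟩
  obtain ⟨x⟩ := hconn.nonempty
  have hx := hcv x
  rw [Set.mem_Icc] at hx
  obtain ⟨u, hu⟩ := key 1 ⟨le_refl _, by omega⟩
  obtain ⟨v, hv⟩ := key t ⟨by omega, le_refl _⟩
  obtain ⟨p, hp, hl⟩ := hconn.exists_path_of_dist u v
  exact ⟨u, v, p, hp, hl, walk_color_bound G cv ce hint p 1 t hu hv⟩
end

section
/- If G is a finite connected simple graph that admits an interval total coloring, then W_τ(G) ≤ 1 + (diam(G) + 1)·Δ(G), where diam(G) is the diameter of G and Δ(G) is the maximum degree of G. -/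
theorem walk_color_bound_s7 {V : Type*} (G : SimpleGraph V) (D : ℕ) (S : V → Set ℕ)
    (hS : ∀ v, ∀ x ∈ S v, ∀ y ∈ S v, y ≤ x + D)
    (hadj : ∀ u v, G.Adj u v → ∃ c, c ∈ S u ∧ c ∈ S v) {u w : V} (p : G.Walk u w) :
    ∀ x ∈ S u, ∀ y ∈ S w, y ≤ x + (p.length + 1) * D := by
  induction p with
  | nil =>
    intro x hx y hy
    simpa using hS _ x hx y hy
  | cons hab p ih =>
    intro x hx y hy
    obtain ⟨c, hc1, hc2⟩ := hadj _ _ hab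
    have h1 := hS _ x hx c hc1
    have h2 := ih c hc2 y hy
    rw [SimpleGraph.Walk.length_cons]
    nlinarith

/-- If `G` is a finite connected simple graph, then every interval total `t`-coloring of
`G` satisfies `t ≤ 1 + (diam(G) + 1) * Δ(G)`; i.e. `W_τ(G) ≤ 1 + (diam(G) + 1) Δ(G)`. -/
theorem W_tau_le_diam_maxDegree {V : Type*} [Fintype V] (G : SimpleGraph V)
    [DecidableRel G.Adj] (hconn : G.Connected) (t : ℕ) (cv : V → ℕ) (ce : Sym2 V → ℕ)
    (h : IsIntervalTotalColoring G t cv ce) :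
    t ≤ 1 + (G.diam + 1) * G.maxDegree := by
  obtain ⟨-, -, -, -, -, hsurj, hint⟩ := h
  rcases Nat.eq_zero_or_pos t with rfl | ht
  · exact Nat.zero_le _
  let S : V → Set ℕ := fun v => {cv v} ∪ ce '' {e ∈ G.edgeSet | v ∈ e}
  have hS : ∀ v, ∀ x ∈ S v, ∀ y ∈ S v, y ≤ x + G.maxDegree := by
    intro v x hx y hy
    obtain ⟨a, ha⟩ := hint v
    have hx' : x ∈ Set.Icc a (a + (G.neighborSet v).ncard) := ha ▸ hx
    have hy' : y ∈ Set.Icc a (a + (G.neighborSet v).ncard) := ha ▸ hy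
    have hd : (G.neighborSet v).ncard = G.degree v := by
      rw [Set.ncard_eq_toFinset_card', ← SimpleGraph.card_neighborFinset_eq_degree]
      rfl
    have := G.degree_le_maxDegree v
    rw [Set.mem_Icc] at hx' hy'
    omega
  have hadj : ∀ u v, G.Adj u v → ∃ c, c ∈ S u ∧ c ∈ S v := by
    intro u v huv
    exact ⟨ce s(u, v), Or.inr ⟨_, ⟨huv, by simp⟩, rfl⟩, Or.inr ⟨_, ⟨huv, by simp⟩, rfl⟩⟩
  have hex : ∀ i ∈ Set.Icc 1 t, ∃ v, i ∈ S v := by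
    intro i hi
    rcases hsurj i hi with ⟨v, hv⟩ | ⟨e, he, hei⟩
    · exact ⟨v, Or.inl hv.symm⟩
    · induction e using Sym2.ind with
      | _ a b => exact ⟨a, Or.inr ⟨_, ⟨he, by simp⟩, hei⟩⟩
  obtain ⟨u, hu⟩ := hex 1 ⟨le_rfl, ht⟩
  obtain ⟨w, hw⟩ := hex t ⟨ht, le_rfl⟩
  obtain ⟨p, hp⟩ := hconn.exists_walk_length_eq_dist u w
  have h1 := walk_color_bound_s7 G G.maxDegree S hS hadj p 1 hu t hw
  haveI : Nonempty V := ⟨u⟩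
  have h2 : G.dist u w ≤ G.diam :=
    SimpleGraph.dist_le_diam (SimpleGraph.connected_iff_ediam_ne_top.mp hconn)
  rw [hp] at h1
  exact h1.trans (by gcongr)
end

section
/- Let G be a finite simple graph with exactly one universal vertex u (i.e., u is the unique vertex with d_G(u) = |V(G)| − 1), and suppose G admits an interval total coloring. Then W_τ(G) ≤ |V(G)| + 2k(G), where k(G) = max over all vertices v ≠ u of d_G(v). -/
/-- If `G` is a finite simple graph with a unique universal vertex `u`, then every
interval total `t`-coloring of `G` satisfies `t ≤ |V(G)| + 2·k(G)`, where
`k(G) = max_{v ≠ u} d_G(v)`; i.e. `W_τ(G) ≤ |V(G)| + 2k(G)`. -/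
theorem W_tau_le_of_unique_universal {V : Type*} [Fintype V] [DecidableEq V]
    (G : SimpleGraph V) (u : V)
    (hu : (G.neighborSet u).ncard = Fintype.card V - 1)
    (huniq : ∀ w, (G.neighborSet w).ncard = Fintype.card V - 1 → w = u)
    (t : ℕ) (cv : V → ℕ) (ce : Sym2 V → ℕ)
    (h : IsIntervalTotalColoring G t cv ce) :
    t ≤ Fintype.card V +
      2 * ((Finset.univ.erase u).sup fun v => (G.neighborSet v).ncard) := by
  obtain ⟨-, -, -, -, -, hall, hint⟩ := h
  have hadj : ∀ v, v ≠ u → G.Adj u v := by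
    intro v hv
    have hsub : G.neighborSet u ⊆ {u}ᶜ := by
      intro x hx
      have hx' : G.Adj u x := hx
      simpa using hx'.ne'
    have hc : ({u}ᶜ : Set V).ncard = Fintype.card V - 1 := by
      rw [Set.ncard_compl, Set.ncard_singleton, Nat.card_eq_fintype_card]
    have heq : G.neighborSet u = {u}ᶜ :=
      Set.eq_of_subset_of_ncard_le hsub (by rw [hc, hu]) (Set.toFinite _)
    have : v ∈ G.neighborSet u := by rw [heq]; simpa using hv
    exact this
  have hpos : 1 ≤ Fintype.card V := Fintype.card_pos_iff.mpr ⟨u⟩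
  set k := (Finset.univ.erase u).sup fun v => (G.neighborSet v).ncard with hk
  obtain ⟨a, ha⟩ := hint u
  rw [hu] at ha
  have key : ∀ i ∈ Set.Icc 1 t, a ≤ i + k ∧ i ≤ a + (Fintype.card V - 1) + k := by
    intro i hi
    have hv : ∃ v, i ∈ {cv v} ∪ ce '' {e ∈ G.edgeSet | v ∈ e} := by
      rcases hall i hi with ⟨v, hv⟩ | ⟨e, he, hce⟩
      · exact ⟨v, Or.inl hv.symm⟩
      · induction e using Sym2.ind with
        | _ x y => exact ⟨x, Or.inr ⟨s(x, y), ⟨he, Sym2.mem_mk_left x y⟩, hce⟩⟩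
    obtain ⟨v, hv⟩ := hv
    by_cases hvu : v = u
    · subst hvu
      rw [ha] at hv
      have h1 := hv.1
      have h2 := hv.2
      omega
    · have hE : s(u, v) ∈ G.edgeSet := hadj v hvu
      have hcu : ce s(u, v) ∈ {cv u} ∪ ce '' {e ∈ G.edgeSet | u ∈ e} :=
        Or.inr ⟨s(u, v), ⟨hE, Sym2.mem_mk_left u v⟩, rfl⟩
      have hcv : ce s(u, v) ∈ {cv v} ∪ ce '' {e ∈ G.edgeSet | v ∈ e} :=
        Or.inr ⟨s(u, v), ⟨hE, Sym2.mem_mk_right u v⟩, rfl⟩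
      obtain ⟨b, hb⟩ := hint v
      rw [hb] at hv hcv
      rw [ha] at hcu
      have hd : (G.neighborSet v).ncard ≤ k :=
        Finset.le_sup (f := fun v => (G.neighborSet v).ncard)
          (Finset.mem_erase.mpr ⟨hvu, Finset.mem_univ v⟩)
      have h1 := hv.1
      have h2 := hv.2
      have h3 := hcu.1
      have h4 := hcu.2
      have h5 := hcv.1
      have h6 := hcv.2
      omega
  rcases Nat.eq_zero_or_pos t with ht | ht
  · omega
  · have h1 := key 1 ⟨le_refl _, ht⟩
    have h2 := key t ⟨ht, le_refl _⟩
    omega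
end

section
/- Every finite tree T with at least one edge has an interval total (Δ(T)+2)-coloring, where Δ(T) is the maximum degree of T; in particular, every tree admits an interval total coloring and w_τ(T) ≤ Δ(T) + 2. -/
universe u

open scoped Classical in
/-- A finite tree whose degrees are at most `D ≤ M` has a proper edge coloring in which the
edges at `v` get colors in an interval of length `D v` inside `{2,…,M+1}`. -/
theorem exists_interval_edge_coloring (M : ℕ) : ∀ (n : ℕ) {V : Type u} [Fintype V]
    (T : SimpleGraph V), Fintype.card V = n → T.IsTree →
    ∀ D : V → ℕ, (∀ v, T.degree v ≤ D v) → (∀ v, D v ≤ M) →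
    ∃ (f : V → V → ℕ) (s : V → ℕ), (∀ x y, f x y = f y x) ∧
      (∀ x y z, T.Adj x y → T.Adj x z → f x y = f x z → y = z) ∧
      (∀ x y, T.Adj x y → s x ≤ f x y ∧ f x y < s x + D x) ∧
      (∀ x, 2 ≤ s x ∧ s x + D x ≤ M + 2) := by
  intro n
  induction n with
  | zero =>
    intro V _ T hc hT
    have := hT.1.nonempty
    exact absurd hc Fintype.card_ne_zero
  | succ n ih =>
    intro V _ T hc hT D hD hM
    rcases subsingleton_or_nontrivial V with hs | hs
    · refine ⟨fun _ _ => 0, fun _ => 2, fun _ _ => rfl, fun _ _ _ _ _ _ => Subsingleton.elim _ _,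
        fun x y h => absurd (Subsingleton.elim x y) h.ne, fun x => ⟨le_rfl, ?_⟩⟩
      have := hM x
      show 2 + D x ≤ M + 2
      omega
    obtain ⟨w, hw⟩ := hT.exists_vert_degree_one_of_nontrivial
    obtain ⟨v, hwv, huniq⟩ := SimpleGraph.degree_eq_one_iff_existsUnique_adj.mp hw
    have hvw : v ≠ w := hwv.ne'
    have hT' : (T.induce {w}ᶜ).IsTree :=
      ⟨hT.1.induce_compl_singleton_of_degree_eq_one hw, hT.2.induce _⟩
    have hcard : Fintype.card ({w}ᶜ : Set V) = n := by
      rw [Fintype.card_compl_set]; simp [hc]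
    have hdeg : ∀ x : ({w}ᶜ : Set V), (T.induce {w}ᶜ).degree x ≤ D x := by
      intro x
      refine le_trans ?_ (hD x)
      rw [← SimpleGraph.card_neighborFinset_eq_degree, ← SimpleGraph.card_neighborFinset_eq_degree]
      apply Finset.card_le_card_of_injOn (fun y : ({w}ᶜ : Set V) => (y : V))
      · intro y hy
        simpa using hy
      · intro a _ b _ h
        exact Subtype.ext h
    obtain ⟨f, s, hsym, hinj, hint, hbd⟩ := ih (T.induce {w}ᶜ) hcard hT' (fun x => D x) hdeg
      (fun x => hM x)
    let v' : ({w}ᶜ : Set V) := ⟨v, hvw⟩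
    let g : V → ℕ := fun y => if h : y ≠ w then f v' ⟨y, h⟩ else 0
    have hlt : (((T.neighborFinset v).erase w).image g).card
        < (Finset.Ico (s v') (s v' + D v)).card := by
      refine lt_of_le_of_lt Finset.card_image_le ?_
      have h1 : w ∈ T.neighborFinset v := by simpa using hwv.symm
      have h2 := Finset.card_erase_lt_of_mem h1
      have h3 := hD v
      rw [SimpleGraph.card_neighborFinset_eq_degree] at h2
      rw [Nat.card_Ico]
      omega
    obtain ⟨c, hc1, hc2⟩ := Finset.exists_mem_notMem_of_card_lt_card hlt
    rw [Finset.mem_Ico] at hc1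
    have hc3 : ∀ y (h : y ≠ w), T.Adj v y → f v' ⟨y, h⟩ ≠ c := by
      intro y h hy he
      apply hc2
      rw [Finset.mem_image]
      refine ⟨y, by simp [h, hy], ?_⟩
      simp only [g, dif_pos h, he]
    have hbv := hbd v'
    have hDw : 1 ≤ D w := hw ▸ hD w
    have hMw := hM w
    have hfw : ∀ x, T.Adj x w → x = v := fun x hx => huniq x hx.symm
    let f' : V → V → ℕ := fun x y => if h : x ≠ w ∧ y ≠ w then f ⟨x, h.1⟩ ⟨y, h.2⟩ else c
    let s' : V → ℕ := fun x => if h : x ≠ w then s ⟨x, h⟩ else max 2 (c + 1 - D w)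
    have f1 : ∀ x y (hx : x ≠ w) (hy : y ≠ w), f' x y = f ⟨x, hx⟩ ⟨y, hy⟩ := by
      intro x y hx hy; simp [f', hx, hy]
    have f2 : ∀ x, f' x w = c := by intro x; simp [f']
    have f3 : ∀ x, f' w x = c := by intro x; simp [f']
    have s1 : ∀ x (hx : x ≠ w), s' x = s ⟨x, hx⟩ := by intro x hx; simp [s', hx]
    have s2 : s' w = max 2 (c + 1 - D w) := by simp [s']
    have hbv2 : s v' + D v ≤ M + 2 := hbv.2
    refine ⟨f', s', ?_, ?_, ?_, ?_⟩
    · intro x y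
      by_cases hx : x = w
      · subst hx; rw [f2, f3]
      by_cases hy : y = w
      · subst hy; rw [f2, f3]
      rw [f1 x y hx hy, f1 y x hy hx, hsym]
    · intro x y z hxy hxz he
      by_cases hx : x = w
      · subst hx; rw [huniq y hxy, huniq z hxz]
      by_cases hy : y = w
      · by_cases hz : z = w
        · rw [hy, hz]
        · subst hy
          have := hfw x hxy
          subst this
          rw [f2, f1 _ _ hx hz] at he
          exact absurd he.symm (hc3 z hz hxz)
      · by_cases hz : z = w
        · subst hz
          have := hfw x hxz
          subst this
          rw [f2, f1 _ _ hx hy] at he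
          exact absurd he (hc3 y hy hxy)
        · rw [f1 _ _ hx hy, f1 _ _ hx hz] at he
          exact congrArg Subtype.val (hinj ⟨x, hx⟩ ⟨y, hy⟩ ⟨z, hz⟩ hxy hxz he)
    · intro x y hxy
      by_cases hx : x = w
      · subst hx; rw [f3, s2]; omega
      by_cases hy : y = w
      · subst hy
        have := hfw x hxy
        subst this
        rw [f2, s1 _ hx]; exact hc1
      rw [f1 _ _ hx hy, s1 _ hx]
      exact hint ⟨x, hx⟩ ⟨y, hy⟩ hxy
    · intro x
      by_cases hx : x = w
      · subst hx; rw [s2]; omega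
      rw [s1 _ hx]
      exact hbd ⟨x, hx⟩

/-- Every finite tree `T` with at least one edge has an interval total
`(Δ(T)+2)`-coloring; in particular every such tree admits an interval total coloring and
`w_τ(T) ≤ Δ(T) + 2`. -/
theorem tree_intervalTotalColoring {V : Type*} [Fintype V] (T : SimpleGraph V)
    (htree : T.IsTree) (hedge : T.edgeSet.Nonempty) :
    ∃ (cv : V → ℕ) (ce : Sym2 V → ℕ),
      IsIntervalTotalColoring T
        ((Finset.univ.sup fun v => (T.neighborSet v).ncard) + 2) cv ce := by
  classical
  have hnc : ∀ v, (T.neighborSet v).ncard = T.degree v := by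
    intro v
    rw [Set.ncard_eq_toFinset_card', ← SimpleGraph.card_neighborFinset_eq_degree]
    rfl
  simp only [IsIntervalTotalColoring, hnc]
  set M := Finset.univ.sup fun v => T.degree v with hMdef
  have hM : ∀ v, T.degree v ≤ M := fun v =>
    Finset.le_sup (f := fun v => T.degree v) (Finset.mem_univ v)
  have := htree.1.nonempty
  obtain ⟨r, -, hr⟩ := Finset.exists_mem_eq_sup Finset.univ Finset.univ_nonempty
    (fun v => T.degree v)
  have hr : T.degree r = M := hr.symm
  obtain ⟨f, s, hsym, hinj, hint, hbd⟩ := exists_interval_edge_coloring M _ T rfl htree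
    (fun v => T.degree v) (fun v => le_rfl) hM
  have hsurj : ∀ x i, s x ≤ i → i < s x + T.degree x → ∃ y, T.Adj x y ∧ f x y = i := by
    intro x i h1 h2
    have himg : (T.neighborFinset x).image (f x) = Finset.Ico (s x) (s x + T.degree x) := by
      apply Finset.eq_of_subset_of_card_le
      · intro j hj
        rw [Finset.mem_image] at hj
        obtain ⟨y, hy, rfl⟩ := hj
        rw [Finset.mem_Ico]
        exact hint x y (by simpa using hy)
      · rw [Finset.card_image_of_injOn, Nat.card_Ico, SimpleGraph.card_neighborFinset_eq_degree]
        · omega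
        · intro y hy z hz h
          exact hinj x y z (by simpa using hy) (by simpa using hz) h
    have : i ∈ (T.neighborFinset x).image (f x) := by
      rw [himg, Finset.mem_Ico]; exact ⟨h1, h2⟩
    rw [Finset.mem_image] at this
    obtain ⟨y, hy, h⟩ := this
    exact ⟨y, by simpa using hy, h⟩
  let col := htree.coloringTwo
  have hcol : ∀ x y, T.Adj x y → (col x = col r ↔ ¬ col y = col r) := by
    intro x y h
    have := col.valid h
    omega
  -- vertices on the side of `r` take the lower end, the other ones the upper end
  let cv : V → ℕ := fun x => if col x = col r then s x - 1 else s x + T.degree x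
  let ce : Sym2 V → ℕ := Sym2.lift ⟨f, hsym⟩
  have hce : ∀ x y, ce s(x, y) = f x y := fun x y => rfl
  have cv1 : ∀ x, col x = col r → cv x = s x - 1 := fun x h => if_pos h
  have cv2 : ∀ x, ¬ col x = col r → cv x = s x + T.degree x := fun x h => if_neg h
  have hMpos : 1 ≤ M := by
    obtain ⟨e, he⟩ := hedge
    induction e using Sym2.ind with
    | _ x y =>
      have h : 0 < T.degree x := (T.degree_pos_iff_exists_adj x).2 ⟨y, he⟩
      have := hM x
      omega
  refine ⟨cv, ce, ?_, ?_, ?_, ?_, ?_, ?_, ?_⟩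
  · intro x y h
    have h1 := hint x y h
    have h2 := hint y x h.symm
    have h3 := hsym x y
    have h4 := hcol x y h
    have h5 := hbd x
    have h6 := hbd y
    by_cases hx : col x = col r
    · rw [cv1 x hx, cv2 y (h4.1 hx)]; omega
    · rw [cv2 x hx, cv1 y (by tauto)]; omega
  · intro e₁ h₁ e₂ h₂ hne x hx₁ hx₂ he
    obtain ⟨y, rfl⟩ := hx₁
    obtain ⟨z, rfl⟩ := hx₂
    exact hne (by rw [hinj x y z h₁ h₂ he])
  · intro x e h hx
    obtain ⟨y, rfl⟩ := hx
    have h1 := hint x y h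
    have h5 := hbd x
    rw [hce]
    by_cases hx : col x = col r
    · rw [cv1 x hx]; omega
    · rw [cv2 x hx]; omega
  · intro x
    have h5 := hbd x
    rw [Set.mem_Icc]
    by_cases hx : col x = col r
    · rw [cv1 x hx]; omega
    · rw [cv2 x hx]; omega
  · intro e h
    induction e using Sym2.ind with
    | _ x y =>
      have h1 := hint x y h
      have h5 := hbd x
      rw [hce, Set.mem_Icc]; omega
  · intro i hi
    rw [Set.mem_Icc] at hi
    have hb := hbd r
    by_cases h1 : i = 1
    · left
      refine ⟨r, ?_⟩
      rw [cv1 r rfl]; omega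
    by_cases h2 : i = M + 2
    · left
      obtain ⟨y, hy, hf⟩ := hsurj r (M + 1) (by omega) (by omega)
      refine ⟨y, ?_⟩
      have h3 := hint y r hy.symm
      have h4 := hsym r y
      have h5 := hbd y
      rw [cv2 y ((hcol r y hy).1 rfl)]
      omega
    · right
      obtain ⟨y, hy, hf⟩ := hsurj r i (by omega) (by omega)
      exact ⟨s(r, y), hy, hf⟩
  · intro x
    have hb := hbd x
    refine ⟨if col x = col r then s x - 1 else s x, ?_⟩
    ext i
    simp only [Set.mem_union, Set.mem_singleton_iff, Set.mem_image, Set.mem_setOf_eq, Set.mem_Icc]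
    have key : (∃ e, (e ∈ T.edgeSet ∧ x ∈ e) ∧ ce e = i) ↔ s x ≤ i ∧ i < s x + T.degree x := by
      constructor
      · rintro ⟨e, ⟨he, ⟨y, rfl⟩⟩, rfl⟩
        exact hint x y he
      · rintro ⟨h1, h2⟩
        obtain ⟨y, hy, hf⟩ := hsurj x i h1 h2
        exact ⟨s(x, y), ⟨hy, Sym2.mem_mk_left x y⟩, hf⟩
    rw [key]
    by_cases hx : col x = col r
    · rw [cv1 x hx, if_pos hx]; omega
    · rw [cv2 x hx, if_neg hx]; omega
end

section
/- For all positive integers m and n, the complete bipartite graph K_{m,n} has an interval total (m+n+1)-coloring; in particular, K_{m,n} admits an interval total coloring and W_τ(K_{m,n}) ≥ m + n + 1. -/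
/-- Weight of a vertex: its index inside its part. -/
def kmnWeight {m n : ℕ} : Fin m ⊕ Fin n → ℕ := Sum.elim (fun i => i.1) (fun j => j.1)

/-- Vertex coloring. -/
def kmnV {m n : ℕ} : Fin m ⊕ Fin n → ℕ :=
  Sum.elim (fun i => i.1 + 1) (fun j => j.1 + m + 2)

/-- Edge coloring. -/
def kmnE {m n : ℕ} : Sym2 (Fin m ⊕ Fin n) → ℕ :=
  Sym2.lift ⟨fun u v => kmnWeight u + kmnWeight v + 2, fun u v => by
    dsimp only; omega⟩

theorem kmnE_mk {m n : ℕ} (i : Fin m) (j : Fin n) :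
    kmnE (s(Sum.inl i, Sum.inr j)) = i.1 + j.1 + 2 := rfl

theorem kmn_edge {m n : ℕ} (e : Sym2 (Fin m ⊕ Fin n)) :
    e ∈ (completeBipartiteGraph (Fin m) (Fin n)).edgeSet ↔
      ∃ i j, e = s(Sum.inl i, Sum.inr j) := by
  constructor
  · induction e using Sym2.ind with
    | _ u v =>
      rcases u with i | i <;> rcases v with j | j <;> intro h
      · simp at h
      · exact ⟨i, j, rfl⟩
      · exact ⟨j, i, Sym2.eq_swap⟩
      · simp at h
  · rintro ⟨i, j, rfl⟩
    simp

theorem kmn_ncard_inl {m n : ℕ} (i : Fin m) :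
    ((completeBipartiteGraph (Fin m) (Fin n)).neighborSet (Sum.inl i)).ncard = n := by
  have : (completeBipartiteGraph (Fin m) (Fin n)).neighborSet (Sum.inl i)
      = Sum.inr '' (Set.univ : Set (Fin n)) := by
    ext v; rcases v with v | v <;> simp
  rw [this, Set.ncard_image_of_injective _ Sum.inr_injective]
  simp [Set.ncard_univ]

theorem kmn_ncard_inr {m n : ℕ} (j : Fin n) :
    ((completeBipartiteGraph (Fin m) (Fin n)).neighborSet (Sum.inr j)).ncard = m := by
  have : (completeBipartiteGraph (Fin m) (Fin n)).neighborSet (Sum.inr j)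
      = Sum.inl '' (Set.univ : Set (Fin m)) := by
    ext v; rcases v with v | v <;> simp
  rw [this, Set.ncard_image_of_injective _ Sum.inl_injective]
  simp [Set.ncard_univ]

/-- For all positive integers `m` and `n`, the complete bipartite graph `K_{m,n}` has an
interval total `(m+n+1)`-coloring; in particular it admits an interval total coloring
and `W_τ(K_{m,n}) ≥ m + n + 1`. -/
theorem completeBipartite_intervalTotalColoring (m n : ℕ) (hm : 1 ≤ m) (hn : 1 ≤ n) :
    ∃ (cv : Fin m ⊕ Fin n → ℕ) (ce : Sym2 (Fin m ⊕ Fin n) → ℕ),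
      IsIntervalTotalColoring (completeBipartiteGraph (Fin m) (Fin n)) (m + n + 1)
        cv ce := by
  refine ⟨kmnV, kmnE, ?_, ?_, ?_, ?_, ?_, ?_, ?_⟩
  · rintro (i | i) (j | j) h
    · simp at h
    · simp only [kmnV, Sum.elim_inl, Sum.elim_inr]; omega
    · simp only [kmnV, Sum.elim_inl, Sum.elim_inr]; omega
    · simp at h
  · intro e₁ h₁ e₂ h₂ hne v hv₁ hv₂ heq
    obtain ⟨i, j, rfl⟩ := (kmn_edge _).1 h₁
    obtain ⟨k, l, rfl⟩ := (kmn_edge _).1 h₂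
    rw [kmnE_mk, kmnE_mk] at heq
    apply hne
    rcases v with v | v
    · simp at hv₁ hv₂
      subst hv₁ hv₂
      have : j = l := Fin.ext (by omega)
      rw [this]
    · simp at hv₁ hv₂
      subst hv₁ hv₂
      have : i = k := Fin.ext (by omega)
      rw [this]
  · intro v e h hv
    obtain ⟨i, j, rfl⟩ := (kmn_edge _).1 h
    rw [kmnE_mk]
    rcases v with v | v
    · simp at hv
      subst hv
      simp only [kmnV, Sum.elim_inl]; omega
    · simp at hv
      subst hv
      simp only [kmnV, Sum.elim_inr]; omega
  · rintro (i | i) <;> simp only [kmnV, Sum.elim_inl, Sum.elim_inr, Set.mem_Icc] <;> omega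
  · intro e h
    obtain ⟨i, j, rfl⟩ := (kmn_edge _).1 h
    rw [kmnE_mk, Set.mem_Icc]
    omega
  · rintro c ⟨h1, h2⟩
    by_cases hc : c ≤ m
    · exact Or.inl ⟨Sum.inl ⟨c - 1, by omega⟩, by simp only [kmnV, Sum.elim_inl]; omega⟩
    by_cases hc' : c = m + 1
    · exact Or.inr ⟨_, (kmn_edge _).2 ⟨⟨m - 1, by omega⟩, ⟨0, by omega⟩, rfl⟩, by
        rw [kmnE_mk]; simp only []; omega⟩
    · exact Or.inl ⟨Sum.inr ⟨c - m - 2, by omega⟩, by simp only [kmnV, Sum.elim_inr]; omega⟩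
  · rintro (i | j)
    · refine ⟨i.1 + 1, ?_⟩
      rw [kmn_ncard_inl]
      ext c
      simp only [Set.mem_union, Set.mem_singleton_iff, Set.mem_image, Set.mem_ofPred_eq,
        Set.mem_Icc, kmnV, Sum.elim_inl]
      constructor
      · rintro (h | ⟨e, ⟨he, hv⟩, rfl⟩)
        · omega
        · obtain ⟨k, l, rfl⟩ := (kmn_edge _).1 he
          simp at hv
          subst hv
          rw [kmnE_mk]; omega
      · rintro ⟨h1, h2⟩
        by_cases hc : c = i.1 + 1
        · exact Or.inl hc
        · refine Or.inr ⟨s(Sum.inl i, Sum.inr ⟨c - i.1 - 2, by omega⟩),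
            ⟨(kmn_edge _).2 ⟨_, _, rfl⟩, by simp⟩, ?_⟩
          rw [kmnE_mk]; simp only []; omega
    · refine ⟨j.1 + 2, ?_⟩
      rw [kmn_ncard_inr]
      ext c
      simp only [Set.mem_union, Set.mem_singleton_iff, Set.mem_image, Set.mem_ofPred_eq,
        Set.mem_Icc, kmnV, Sum.elim_inr]
      constructor
      · rintro (h | ⟨e, ⟨he, hv⟩, rfl⟩)
        · omega
        · obtain ⟨k, l, rfl⟩ := (kmn_edge _).1 he
          simp at hv
          subst hv
          rw [kmnE_mk]; omega
      · rintro ⟨h1, h2⟩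
        by_cases hc : c = j.1 + m + 2
        · exact Or.inl hc
        · refine Or.inr ⟨s(Sum.inl ⟨c - j.1 - 2, by omega⟩, Sum.inr j),
            ⟨(kmn_edge _).2 ⟨_, _, rfl⟩, by simp⟩, ?_⟩
          rw [kmnE_mk]; simp only []; omega
end

section
/- For every n ≥ 3, the cycle C_n admits an interval total coloring, and its least number of colors satisfies w_τ(C_n) = 3 if n is divisible by 3 and w_τ(C_n) = 4 if n is not divisible by 3. -/
open SimpleGraph in
theorem cyc_edge {m : ℕ} (e : Sym2 (Fin (m+3))) :
    e ∈ (cycleGraph (m+3)).edgeSet ↔ ∃ i, e = s(i, i+1) := by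
  induction e with
  | _ u v =>
    rw [mem_edgeSet, cycleGraph_adj (n := m+1)]
    constructor
    · rintro (h | h)
      · refine ⟨v, ?_⟩
        rw [Sym2.eq_swap, ← h, add_sub_cancel]
      · refine ⟨u, ?_⟩
        rw [← h, add_sub_cancel]
    · rintro ⟨i, h⟩
      rw [Sym2.eq_iff] at h
      rcases h with ⟨rfl, rfl⟩ | ⟨rfl, rfl⟩
      · right; exact add_sub_cancel_left _ _
      · left; exact add_sub_cancel_left _ _

theorem cyc_val {m : ℕ} (i : Fin (m+3)) :
    (i.1 + 1 < m + 3 ∧ (i+1).1 = i.1 + 1) ∨ (i.1 + 1 = m + 3 ∧ (i+1).1 = 0) := by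
  have := Fin.val_add_one (n := m+2) i
  have h2 := i.2
  split_ifs at this with h
  · right
    rw [h]; simp
  · left
    have h3 : i.1 ≠ m+2 := fun h' => h (Fin.ext (by simpa using h'))
    exact ⟨by omega, this⟩

theorem cyc_ne {m : ℕ} (i : Fin (m+3)) : i ≠ i + 1 := by
  have h1 := cyc_val i
  intro h
  have := congrArg Fin.val h
  omega

theorem cyc_ne2 {m : ℕ} (i : Fin (m+3)) : i ≠ i + 1 + 1 := by
  have h1 := cyc_val i
  have h2 := cyc_val (i+1)
  intro h
  have := congrArg Fin.val h
  omega

theorem cyc_inj {m : ℕ} (i j : Fin (m+3)) (h : s(i, i+1) = s(j, j+1)) : i = j := by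
  rw [Sym2.eq_iff] at h
  rcases h with ⟨h, _⟩ | ⟨h, h'⟩
  · exact h
  · exfalso
    subst h
    exact cyc_ne2 j h'.symm

theorem cyc_mem {m : ℕ} (v i : Fin (m+3)) : v + 1 ∈ s(i, i+1) ↔ i = v + 1 ∨ i = v := by
  rw [Sym2.mem_iff]
  constructor
  · rintro (h | h)
    · exact Or.inl h.symm
    · exact Or.inr (add_right_cancel h).symm
  · rintro (h | h)
    · exact Or.inl h.symm
    · exact Or.inr (by rw [h])

open SimpleGraph in
theorem cyc_ncard {m : ℕ} (v : Fin (m+3)) : ((cycleGraph (m+3)).neighborSet v).ncard = 2 := by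
  rw [Set.ncard_eq_toFinset_card', Set.toFinset_card, card_neighborSet_eq_degree,
    cycleGraph_degree_three_le]

theorem cyc_pred {m : ℕ} (v : Fin (m+3)) : ∃ u, v = u + 1 := ⟨v - 1, by simp⟩

open SimpleGraph in
theorem cyc_inc {m : ℕ} (v : Fin (m+3)) (cv : Fin (m+3) → ℕ) (ce : Sym2 (Fin (m+3)) → ℕ) :
    {cv (v+1)} ∪ ce '' {e ∈ (cycleGraph (m+3)).edgeSet | v + 1 ∈ e}
      = {cv (v+1), ce s(v, v+1), ce s(v+1, v+1+1)} := by
  have : {e ∈ (cycleGraph (m+3)).edgeSet | v + 1 ∈ e} = {s(v, v+1), s(v+1, v+1+1)} := by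
    ext e
    simp only [Set.mem_insert_iff, Set.mem_singleton_iff, cyc_edge]
    constructor
    · rintro ⟨⟨i, rfl⟩, h⟩
      rcases (cyc_mem v i).1 h with rfl | rfl
      · right; rfl
      · left; rfl
    · rintro (rfl | rfl)
      · exact ⟨⟨_, rfl⟩, by simp⟩
      · exact ⟨⟨_, rfl⟩, by simp⟩
  rw [this, Set.image_pair]
  rfl

open SimpleGraph in
theorem cyc_build {m : ℕ} (t : ℕ) (V E : Fin (m+3) → ℕ)
    (h1 : ∀ i, V i ≠ V (i+1)) (h2 : ∀ i, E i ≠ E (i+1))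
    (h3 : ∀ i, V i ≠ E i) (h4 : ∀ i, V (i+1) ≠ E i)
    (h5 : ∀ i, 1 ≤ V i ∧ V i ≤ t) (h6 : ∀ i, 1 ≤ E i ∧ E i ≤ t)
    (h7 : ∀ k, 1 ≤ k → k ≤ t → (∃ i, V i = k) ∨ ∃ i, E i = k)
    (h8 : ∀ i, ∃ a, ∀ x, (x = V (i+1) ∨ x = E i ∨ x = E (i+1)) ↔ (a ≤ x ∧ x ≤ a + 2)) :
    ∃ (cv : Fin (m+3) → ℕ) (ce : Sym2 (Fin (m+3)) → ℕ),
        IsIntervalTotalColoring (SimpleGraph.cycleGraph (m+3)) t cv ce := by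
  have hinj : Function.Injective (fun i : Fin (m+3) => s(i, i+1)) := fun i j h => cyc_inj i j h
  obtain ⟨ce, hce⟩ : ∃ ce : Sym2 (Fin (m+3)) → ℕ, ∀ i, ce s(i, i+1) = E i :=
    ⟨Function.extend (fun i : Fin (m+3) => s(i, i+1)) E (fun _ => 0),
      fun i => hinj.extend_apply E _ i⟩
  refine ⟨V, ce, ?_, ?_, ?_, ?_, ?_, ?_, ?_⟩
  · intro u v h
    rw [← mem_edgeSet, cyc_edge] at h
    obtain ⟨i, h⟩ := h
    rw [Sym2.eq_iff] at h
    rcases h with ⟨rfl, rfl⟩ | ⟨rfl, rfl⟩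
    · exact h1 _
    · exact (h1 _).symm
  · intro e₁ he₁ e₂ he₂ hne v hv1 hv2
    obtain ⟨i, rfl⟩ := (cyc_edge _).1 he₁
    obtain ⟨j, rfl⟩ := (cyc_edge _).1 he₂
    obtain ⟨u, rfl⟩ := cyc_pred v
    rw [hce, hce]
    rcases (cyc_mem _ _).1 hv1 with rfl | rfl <;> rcases (cyc_mem _ _).1 hv2 with rfl | rfl
    · exact absurd rfl hne
    · exact (h2 _).symm
    · exact h2 _
    · exact absurd rfl hne
  · intro v e he hv
    obtain ⟨i, rfl⟩ := (cyc_edge _).1 he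
    obtain ⟨u, rfl⟩ := cyc_pred v
    rw [hce]
    rcases (cyc_mem _ _).1 hv with rfl | rfl
    · exact h3 _
    · exact h4 _
  · exact h5
  · intro e he
    obtain ⟨i, rfl⟩ := (cyc_edge _).1 he
    rw [hce]; exact h6 i
  · rintro k ⟨hk1, hk2⟩
    rcases h7 k hk1 hk2 with h | ⟨i, hi⟩
    · exact Or.inl h
    · exact Or.inr ⟨s(i, i+1), (cyc_edge _).2 ⟨i, rfl⟩, by rw [hce, hi]⟩
  · intro v
    obtain ⟨u, rfl⟩ := cyc_pred v
    obtain ⟨a, ha⟩ := h8 u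
    refine ⟨a, ?_⟩
    rw [cyc_inc, cyc_ncard, hce, hce]
    ext x
    simpa using ha x

def cycV (s i : ℕ) : ℕ :=
  if i < s then (if i % 3 = 0 then 1 else if i % 3 = 1 then 3 else 2)
  else if (i - s) % 2 = 0 then 1 else 4

def cycE (s i : ℕ) : ℕ :=
  if i < s then (if i % 3 = 0 then 2 else if i % 3 = 1 then 1 else 3)
  else if (i - s) % 2 = 0 then 2 else 3

/-- Local description of two consecutive positions of the pattern. -/
theorem cyc_pat {m : ℕ} (s : ℕ) (hs : s % 3 = 0) (hs' : s ≤ m + 3) (hp : (m + 3 - s) % 2 = 0)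
    (i : Fin (m+3)) :
    (cycE s i = 2 ∧ cycV s i = 1 ∧ cycV s (i+1).1 = 3 ∧ cycE s (i+1).1 = 1) ∨
    (cycE s i = 1 ∧ cycV s i = 3 ∧ cycV s (i+1).1 = 2 ∧ cycE s (i+1).1 = 3) ∨
    (cycE s i = 3 ∧ cycV s i = 2 ∧ cycV s (i+1).1 = 1 ∧ cycE s (i+1).1 = 2) ∨
    (s < m + 3 ∧ cycE s i = 2 ∧ cycV s i = 1 ∧ cycV s (i+1).1 = 4 ∧ cycE s (i+1).1 = 3) ∨
    (s < m + 3 ∧ cycE s i = 3 ∧ cycV s i = 4 ∧ cycV s (i+1).1 = 1 ∧ cycE s (i+1).1 = 2) := by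
  have h := cyc_val i
  have h2 := i.2
  generalize (i+1).1 = j at *
  generalize i.1 = i at *
  unfold cycV cycE
  rcases h with ⟨h, rfl⟩ | ⟨h, rfl⟩
  · by_cases a : i + 1 < s
    · have : i < s := by omega
      simp only [a, this, if_true]
      have : i % 3 = 0 ∨ i % 3 = 1 ∨ i % 3 = 2 := by omega
      rcases this with c | c | c <;> simp [c, Nat.add_mod]
    · by_cases b : i < s
      · have e1 : i % 3 = 2 := by omega
        have e2 : i + 1 - s = 0 := by omega
        simp [a, b, e1, e2]
      · have : s < m + 3 := by omega
        rcases Nat.mod_two_eq_zero_or_one (i - s) with c | c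
        · have : (i + 1 - s) % 2 = 1 := by omega
          simp [a, b, c, this]; omega
        · have : (i + 1 - s) % 2 = 0 := by omega
          simp [a, b, c, this]; omega
  · by_cases b : i < s
    · have e1 : i % 3 = 2 := by omega
      have : 0 < s := by omega
      simp [b, e1, this]
    · have c : (i - s) % 2 = 1 := by omega
      have : s < m + 3 := by omega
      by_cases d : 0 < s
      · simp [b, c, d, this]
      · have : s = 0 := by omega
        subst this
        simp at c
        simp [c]

theorem cyc_upper {m t : ℕ} (s : ℕ) (hs : s % 3 = 0) (hs' : s ≤ m + 3)
    (hp : (m + 3 - s) % 2 = 0)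
    (ht : (t = 3 ∧ s = m + 3) ∨ (t = 4 ∧ s + 2 ≤ m + 3)) :
    ∃ (cv : Fin (m+3) → ℕ) (ce : Sym2 (Fin (m+3)) → ℕ),
        IsIntervalTotalColoring (SimpleGraph.cycleGraph (m+3)) t cv ce := by
  have P := cyc_pat s hs hs' hp
  apply cyc_build t (fun i => cycV s i) (fun i => cycE s i)
  · intro i; have := P i; omega
  · intro i; have := P i; omega
  · intro i; have := P i; omega
  · intro i; have := P i; omega
  · intro i; have := P i; omega
  · intro i; have := P i; omega
  · intro k h1 hk
    rcases ht with ⟨rfl, rfl⟩ | ⟨rfl, hlt⟩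
    · left
      interval_cases k
      · exact ⟨⟨0, by omega⟩, by simp [cycV]⟩
      · exact ⟨⟨2, by omega⟩, by simp [cycV]⟩
      · exact ⟨⟨1, by omega⟩, by simp [cycV]⟩
    · interval_cases k
      · left; exact ⟨⟨s, by omega⟩, by simp [cycV]⟩
      · right; exact ⟨⟨s, by omega⟩, by simp [cycE]⟩
      · right; exact ⟨⟨s+1, by omega⟩, by simp [cycE]⟩
      · left; exact ⟨⟨s+1, by omega⟩, by simp [cycV]⟩
  · intro i
    rcases P i with h | h | h | ⟨_, h⟩ | ⟨_, h⟩ <;> obtain ⟨a, b, c, d⟩ := h <;> rw [a, c, d]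
    · exact ⟨1, by omega⟩
    · exact ⟨1, by omega⟩
    · exact ⟨1, by omega⟩
    · exact ⟨2, by omega⟩
    · exact ⟨1, by omega⟩

open SimpleGraph in
open Fin.NatCast Fin.CommRing in
theorem cyc_lower {m t : ℕ} (cv : Fin (m+3) → ℕ) (ce : Sym2 (Fin (m+3)) → ℕ)
    (h : IsIntervalTotalColoring (SimpleGraph.cycleGraph (m+3)) t cv ce) :
    3 ≤ t ∧ (t = 3 → 3 ∣ m + 3) := by
  obtain ⟨h1, h2, h3, h4, h5, -, -⟩ := h
  have he : ∀ i : Fin (m+3), s(i, i+1) ∈ (cycleGraph (m+3)).edgeSet :=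
    fun i => (cyc_edge _).2 ⟨i, rfl⟩
  have a1 : ∀ i, cv i ≠ cv (i+1) := fun i => h1 _ _ (he i)
  have a2 : ∀ i, ce s(i, i+1) ≠ ce s(i+1, i+1+1) := fun i =>
    h2 _ (he i) _ (he (i+1)) (fun hh => cyc_ne i (cyc_inj _ _ hh)) (i+1) (by simp) (by simp)
  have a3 : ∀ i, cv i ≠ ce s(i, i+1) := fun i => h3 _ _ (he i) (by simp)
  have a4 : ∀ i, cv (i+1) ≠ ce s(i, i+1) := fun i => h3 _ _ (he i) (by simp)
  have a5 : ∀ i, 1 ≤ cv i ∧ cv i ≤ t := h4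
  have a6 : ∀ i : Fin (m+3), 1 ≤ ce s(i, i+1) ∧ ce s(i, i+1) ≤ t := fun i => h5 _ (he i)
  constructor
  · have := a2 0; have := a4 0; have := a3 (0+1)
    have := a5 (0+1); have := a6 0; have := a6 (0+1)
    omega
  · rintro rfl
    have b1 : ∀ i, cv (i+1+1) = ce s(i, i+1) := by
      intro i
      have := a1 (i+1); have := a2 i; have := a4 i; have := a3 (i+1); have := a4 (i+1)
      have := a5 (i+1); have := a6 i; have := a6 (i+1); have := a5 (i+1+1)
      omega
    have b2 : ∀ i, ce s(i+1, i+1+1) = cv i := by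
      intro i
      have := a1 i; have := a2 i; have := a4 i; have := a3 (i+1); have := a3 i
      have := a5 (i+1); have := a6 i; have := a6 (i+1); have := a5 i
      omega
    have b3 : ∀ i, cv (i+1+1+1) = cv i := fun i => by rw [b1, b2]
    have c3 : ∀ q : ℕ, ∀ i, cv (i + ((3 * q : ℕ) : Fin (m+3))) = cv i := by
      intro q
      induction q with
      | zero => intro i; simp
      | succ q ih =>
        intro i
        refine Eq.trans ?_ ((b3 (i + ((3 * q : ℕ) : Fin (m+3)))).trans (ih i))
        congr 1
        push_cast
        ring
    by_contra hd
    have hz : ((m + 3 : ℕ) : Fin (m+3)) = 0 := Fin.natCast_self _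
    have : (m + 3) % 3 = 1 ∨ (m + 3) % 3 = 2 := by omega
    rcases this with hm | hm
    · have e : m + 3 = 3 * ((m+3)/3) + 1 := by omega
      have k := c3 ((m+3)/3) (0+1)
      have e2 : (0 + 1 + ((3 * ((m+3)/3) : ℕ) : Fin (m+3))) = 0 := by
        have := congrArg (Nat.cast : ℕ → Fin (m+3)) e
        rw [hz, Nat.cast_add, Nat.cast_one] at this
        rw [zero_add]; exact (add_comm _ _).trans this.symm
      rw [e2] at k
      exact a1 0 k
    · have e : m + 3 + 1 = 3 * ((m+3)/3 + 1) := by omega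
      have k := c3 ((m+3)/3+1) 0
      rw [← e, Nat.cast_add, hz, Nat.cast_one, zero_add] at k
      exact a1 0 (by rw [zero_add]; exact k.symm)

/-- For every `n ≥ 3` the cycle `Cₙ` admits an interval total coloring, and the least
number of colors in such a coloring is `3` if `3 ∣ n` and `4` otherwise:
`w_τ(Cₙ) = 3` if `n = 3k` and `w_τ(Cₙ) = 4` if `n ≠ 3k`. -/
theorem w_tau_cycleGraph (n : ℕ) (hn : 3 ≤ n) :
    IsLeast {t : ℕ | ∃ (cv : Fin n → ℕ) (ce : Sym2 (Fin n) → ℕ),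
        IsIntervalTotalColoring (SimpleGraph.cycleGraph n) t cv ce}
      (if 3 ∣ n then 3 else 4) := by
  obtain ⟨m, rfl⟩ : ∃ m, n = m + 3 := ⟨n - 3, by omega⟩
  constructor
  · show ∃ cv ce, _
    split_ifs with h
    · exact cyc_upper (m+3) (by omega) (by omega) (by omega) (by omega)
    · by_cases h2 : (m + 3) % 2 = 0
      · exact cyc_upper 0 (by omega) (by omega) (by omega) (by omega)
      · exact cyc_upper 3 (by omega) (by omega) (by omega) (by omega)
  · rintro t ⟨cv, ce, h⟩
    have := cyc_lower cv ce h
    split_ifs with h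
    · exact this.1
    · have h3 : t ≠ 3 := fun h' => h (this.2 h')
      omega
end

section
/- For every n ≥ 3, the cycle C_n satisfies W_τ(C_n) = n + 2: C_n has an interval total (n+2)-coloring, and it has no interval total t-coloring with t > n + 2. -/
namespace CycW

variable {m : ℕ}

lemma ne_aux (k : Fin (m+3)) : k + 1 ≠ k ∧ k + 1 + 1 ≠ k := by
  constructor
  · intro h
    simp at h
  · intro h
    rw [add_assoc] at h
    have : (1 + 1 : Fin (m+3)) = 0 := by simpa using h
    have := congrArg Fin.val this
    simp [Fin.val_add] at this
    rw [Nat.mod_eq_of_lt (by omega)] at this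
    omega

lemma mem_edge (e : Sym2 (Fin (m+3))) :
    e ∈ (SimpleGraph.cycleGraph (m+3)).edgeSet ↔ ∃ k, e = s(k, k+1) := by
  induction e with
  | _ x y =>
    rw [SimpleGraph.mem_edgeSet, SimpleGraph.cycleGraph_adj]
    constructor
    · rintro (h | h)
      · exact ⟨y, by rw [Sym2.eq_swap, ← h]; simp⟩
      · exact ⟨x, by rw [← h]; simp⟩
    · rintro ⟨k, hk⟩
      rw [Sym2.eq_iff] at hk
      rcases hk with ⟨rfl, rfl⟩ | ⟨rfl, rfl⟩
      · right; simp
      · left; simp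

lemma edge_inj : Function.Injective (fun k : Fin (m+3) => s(k, k+1)) := by
  intro a b h
  simp only [Sym2.eq_iff] at h
  rcases h with ⟨h, _⟩ | ⟨h1, h2⟩
  · exact h
  · exfalso
    subst h1
    exact (ne_aux b).2 h2

lemma inc (v : Fin (m+3)) :
    {e ∈ (SimpleGraph.cycleGraph (m+3)).edgeSet | v + 1 ∈ e} =
      {s(v, v+1), s(v+1, v+1+1)} := by
  ext e
  simp only [Set.mem_ofPred_eq, mem_edge, Set.mem_insert_iff, Set.mem_singleton_iff]
  constructor
  · rintro ⟨⟨k, rfl⟩, h⟩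
    rw [Sym2.mem_iff] at h
    rcases h with h | h
    · right; rw [h]
    · left; rw [add_right_cancel h]
  · rintro (rfl | rfl)
    · exact ⟨⟨v, rfl⟩, by simp⟩
    · exact ⟨⟨v+1, rfl⟩, by simp⟩

lemma nb (v : Fin (m+3)) :
    ((SimpleGraph.cycleGraph (m+3)).neighborSet v).ncard = 2 := by
  rw [Set.ncard_eq_toFinset_card']
  exact SimpleGraph.cycleGraph_degree_three_le

lemma main_iff (t : ℕ) (cv : Fin (m+3) → ℕ) (ce : Sym2 (Fin (m+3)) → ℕ)
    (g : Fin (m+3) → ℕ) (hg : ∀ k, g k = ce s(k, k+1)) :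
    IsIntervalTotalColoring (SimpleGraph.cycleGraph (m+3)) t cv ce ↔
    (∀ k, cv k ≠ cv (k+1)) ∧ (∀ k, g k ≠ g (k+1)) ∧
    (∀ k, cv (k+1) ≠ g k ∧ cv (k+1) ≠ g (k+1)) ∧
    (∀ k, cv k ∈ Set.Icc 1 t) ∧ (∀ k, g k ∈ Set.Icc 1 t) ∧
    (∀ i ∈ Set.Icc 1 t, (∃ v, cv v = i) ∨ ∃ k, g k = i) ∧
    (∀ k, ∃ a, ({cv (k+1), g k, g (k+1)} : Set ℕ) = Set.Icc a (a+2)) := by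
  have sh : ∀ v : Fin (m+3), ∃ w, v = w + 1 := fun v => ⟨v - 1, by simp⟩
  have hE : ∀ k : Fin (m+3), s(k, k+1) ∈ (SimpleGraph.cycleGraph (m+3)).edgeSet :=
    fun k => (mem_edge _).2 ⟨k, rfl⟩
  have hset : ∀ k : Fin (m+3),
      {cv (k+1)} ∪ ce '' {e ∈ (SimpleGraph.cycleGraph (m+3)).edgeSet | k+1 ∈ e}
        = ({cv (k+1), g k, g (k+1)} : Set ℕ) := by
    intro k
    rw [inc, Set.image_pair, ← hg, ← hg]; rfl
  constructor
  · rintro ⟨h1, h2, h3, h4, h5, h6, h7⟩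
    refine ⟨fun k => h1 _ _ (hE k), fun k => ?_, fun k => ⟨?_, ?_⟩, h4,
      fun k => hg k ▸ h5 _ (hE k), fun i hi => ?_, fun k => ?_⟩
    · rw [hg, hg]
      refine h2 _ (hE _) _ (hE _) (fun h => (ne_aux k).1 (edge_inj h).symm) (k+1) ?_ ?_ <;> simp
    · rw [hg]; exact h3 _ _ (hE _) (by simp)
    · rw [hg]; exact h3 _ _ (hE _) (by simp)
    · rcases h6 i hi with h | ⟨e, he, h⟩
      · exact Or.inl h
      · obtain ⟨k, rfl⟩ := (mem_edge e).1 he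
        exact Or.inr ⟨k, by rw [hg, h]⟩
    · have := h7 (k+1)
      rwa [hset, nb] at this
  · rintro ⟨h1, h2, h3, h4, h5, h6, h7⟩
    refine ⟨fun u v h => ?_, fun e₁ he₁ e₂ he₂ hne v hv₁ hv₂ => ?_, fun v e he hv => ?_, h4,
      fun e he => ?_, fun i hi => ?_, fun v => ?_⟩
    · have := (mem_edge s(u,v)).1 h
      obtain ⟨k, hk⟩ := this
      rw [Sym2.eq_iff] at hk
      rcases hk with ⟨rfl, rfl⟩ | ⟨rfl, rfl⟩
      · exact h1 _
      · exact (h1 _).symm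
    · obtain ⟨w, rfl⟩ := sh v
      have a1 : e₁ ∈ {e ∈ (SimpleGraph.cycleGraph (m+3)).edgeSet | w + 1 ∈ e} := ⟨he₁, hv₁⟩
      have a2 : e₂ ∈ {e ∈ (SimpleGraph.cycleGraph (m+3)).edgeSet | w + 1 ∈ e} := ⟨he₂, hv₂⟩
      rw [inc] at a1 a2
      have := h2 w
      rw [hg, hg] at this
      rcases a1 with rfl | rfl <;> rcases a2 with rfl | rfl
      · exact absurd rfl hne
      · exact this
      · exact this.symm
      · exact absurd rfl hne
    · obtain ⟨w, rfl⟩ := sh v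
      have a1 : e ∈ {e ∈ (SimpleGraph.cycleGraph (m+3)).edgeSet | w + 1 ∈ e} := ⟨he, hv⟩
      rw [inc] at a1
      have := h3 w
      rw [hg, hg] at this
      rcases a1 with rfl | rfl
      · exact this.1
      · exact this.2
    · obtain ⟨k, rfl⟩ := (mem_edge e).1 he
      exact hg k ▸ h5 k
    · rcases h6 i hi with h | ⟨k, h⟩
      · exact Or.inl h
      · exact Or.inr ⟨_, hE k, by rw [← hg, h]⟩
    · obtain ⟨w, rfl⟩ := sh v
      rw [hset, nb]
      exact h7 w

lemma upper (t : ℕ) (cv g : Fin (m+3) → ℕ)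
    (h2 : ∀ k, g k ≠ g (k+1))
    (h4 : ∀ k, cv k ∈ Set.Icc 1 t) (h5 : ∀ k, g k ∈ Set.Icc 1 t)
    (h6 : ∀ i ∈ Set.Icc 1 t, (∃ v, cv v = i) ∨ ∃ k, g k = i)
    (h7 : ∀ k, ∃ a, ({cv (k+1), g k, g (k+1)} : Set ℕ) = Set.Icc a (a+2)) :
    t ≤ m + 5 := by
  by_contra! hlt
  have bd : ∀ k, ∃ a, (a ≤ cv (k+1) ∧ cv (k+1) ≤ a+2) ∧ (a ≤ g k ∧ g k ≤ a+2) ∧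
      (a ≤ g (k+1) ∧ g (k+1) ≤ a + 2) := by
    intro k
    obtain ⟨a, ha⟩ := h7 k
    refine ⟨a, ?_, ?_, ?_⟩ <;> rw [← Set.mem_Icc, ← ha] <;> simp
  have near : ∀ c ∈ Set.Icc 1 t, ∃ k, (g k ≤ c + 2 ∧ c ≤ g k + 2) ∧
      (g (k+1) ≤ c + 2 ∧ c ≤ g (k+1) + 2) := by
    intro c hc
    rcases h6 c hc with ⟨v, rfl⟩ | ⟨k, rfl⟩
    · refine ⟨v - 1, ?_⟩
      obtain ⟨a, ha⟩ := bd (v-1)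
      simp only [sub_add_cancel] at ha ⊢
      omega
    · refine ⟨k, ?_⟩
      obtain ⟨a, ha⟩ := bd k
      omega
  let G : ℕ → ℕ := fun k => g (Fin.ofNat (m+3) k)
  have cs : ∀ k, Fin.ofNat (m+3) (k+1) = Fin.ofNat (m+3) k + 1 := by
    intro k
    apply Fin.ext
    simp [Fin.val_add]
  have Gs : ∀ k, G (k+1) ≤ G k + 2 ∧ G k ≤ G (k+1) + 2 := by
    intro k
    obtain ⟨a, ha⟩ := bd (Fin.ofNat (m+3) k)
    simp only [G, cs]
    omega
  have Gd : ∀ k d, G (k+d) ≤ G k + 2 * d := by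
    intro k d
    induction d with
    | zero => simp
    | succ d ih => have := (Gs (k+d)).1; rw [← add_assoc]; omega
  have Gp : ∀ k, G (k + (m+3)) = G k := by
    intro k
    simp only [G]
    congr 1
    apply Fin.ext
    simp
  have Gne : ∀ k, G k ≠ G (k+1) := by
    intro k
    have := h2 (Fin.ofNat (m+3) k)
    simpa only [G, cs] using this
  have Gb : ∀ k, 1 ≤ G k ∧ G k ≤ t := fun k => h5 _
  obtain ⟨i, hi⟩ := near 1 ⟨le_rfl, by omega⟩
  obtain ⟨j, hj⟩ := near t ⟨by omega, le_rfl⟩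
  have ei : ∀ k : Fin (m+3), g k = G k.val ∧ g (k+1) = G (k.val+1) := by
    intro k; simp only [G, cs, Fin.ofNat_val_eq_self, and_self]
  rw [(ei i).1, (ei i).2] at hi
  rw [(ei j).1, (ei j).2] at hj
  obtain ⟨jj, hjj, h1, hlt2⟩ : ∃ jj : ℕ, (t ≤ G jj + 2 ∧ t ≤ G (jj+1) + 2) ∧
      i.val ≤ jj ∧ jj < i.val + (m+3) := by
    by_cases h : i.val ≤ j.val
    · exact ⟨j.val, ⟨hj.1.2, hj.2.2⟩, h, by omega⟩
    · refine ⟨j.val + (m+3), ?_, by omega, by omega⟩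
      rw [add_right_comm, Gp, Gp]
      exact ⟨hj.1.2, hj.2.2⟩
  have n1 := Gne i
  have n2 := Gne jj
  have b1 := Gb i
  have b2 := Gb (i+1)
  have b3 := Gb jj
  have b4 := Gb (jj+1)
  rcases Nat.eq_or_lt_of_le h1 with h | h
  · rw [← h] at hjj
    omega
  · have c1 := Gd (i+1) (jj - (i+1))
    rw [show i.val+1 + (jj - (i+1)) = jj by omega] at c1
    have c2 : G (jj+1) ≤ G i + 2 * (i + (m+3) - (jj+1)) := by
      have c3 : ∀ k d, G k ≤ G (k+d) + 2 * d := by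
        intro k d
        induction d with
        | zero => simp
        | succ d ih => have := (Gs (k+d)).2; rw [← add_assoc]; omega
      have := c3 (jj+1) (i + (m+3) - (jj+1))
      rwa [show jj+1 + (i.val + (m+3) - (jj+1)) = i + (m+3) by omega, Gp] at this
    omega

/-- Edge colors of the extremal coloring on `C_n`. -/
def E (n k : ℕ) : ℕ := if k < (n+1)/2 then 2*k+2 else 2*n+1-2*k

/-- Vertex colors of the extremal coloring on `C_n`. -/
def C (n k : ℕ) : ℕ :=
  if k = 0 then 1 else if k < (n+1)/2 then 2*k+1 else if k = (n+1)/2 then n+2 else 2*n+2-2*k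

lemma triple (x y z a : ℕ) (h : ∀ c, (c = x ∨ c = y ∨ c = z) ↔ (a ≤ c ∧ c ≤ a + 2)) :
    ({x, y, z} : Set ℕ) = Set.Icc a (a+2) := by
  ext c; simpa using h c

lemma succ_val (k : Fin (m+3)) :
    ((k+1).val = k.val + 1 ∧ k.val + 1 < m+3) ∨ ((k+1).val = 0 ∧ k.val = m+2) := by
  have h := Fin.val_add_one k
  have := k.2
  split_ifs at h with hh
  · right; exact ⟨h, by rw [hh]; simp⟩
  · left; refine ⟨h, ?_⟩
    have : k.val ≠ m + 2 := fun hk => hh (Fin.ext (by simpa using hk))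
    clear h
    omega

end CycW

open CycW in
/-- For every `n ≥ 3` the cycle `Cₙ` satisfies `W_τ(Cₙ) = n + 2` : it has an interval
total `(n+2)`-coloring and no interval total `t`-coloring with `t > n + 2`. -/
theorem W_tau_cycleGraph (n : ℕ) (hn : 3 ≤ n) :
    IsGreatest {t : ℕ | ∃ (cv : Fin n → ℕ) (ce : Sym2 (Fin n) → ℕ),
        IsIntervalTotalColoring (SimpleGraph.cycleGraph n) t cv ce}
      (n + 2) := by
  obtain ⟨m, rfl⟩ : ∃ m, n = m + 3 := ⟨n - 3, by omega⟩
  constructor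
  · refine ⟨fun k => C (m+3) k, Function.extend (fun k : Fin (m+3) => s(k, k+1))
      (fun k => E (m+3) k) 0, ?_⟩
    rw [main_iff _ _ _ (fun k => E (m+3) k)
      (fun k => (edge_inj.extend_apply (fun k : Fin (m+3) => E (m+3) k) 0 k).symm)]
    refine ⟨fun k => ?_, fun k => ?_, fun k => ?_, fun k => ?_, fun k => ?_, fun i hi => ?_,
      fun k => ?_⟩
    · have := succ_val k
      generalize k + 1 = l at *
      simp only [C]; split_ifs <;> omega
    · have := succ_val k
      generalize k + 1 = l at *
      simp only [E]; split_ifs <;> omega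
    · have := succ_val k
      generalize k + 1 = l at *
      simp only [E, C]; split_ifs <;> omega
    · have := k.2
      simp only [C, Set.mem_Icc]; split_ifs <;> omega
    · have := k.2
      simp only [E, Set.mem_Icc]; split_ifs <;> omega
    · rw [Set.mem_Icc] at hi
      by_cases h1 : i = 1
      · left; exact ⟨⟨0, by omega⟩, by simp [C, h1]⟩
      by_cases h2 : i = m + 5
      · left; exact ⟨⟨(m+3+1)/2, by omega⟩, by simp only [C]; split_ifs <;> omega⟩
      right
      by_cases h3 : i % 2 = 0
      · exact ⟨⟨(i-2)/2, by omega⟩, by simp only [E]; split_ifs <;> omega⟩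
      · exact ⟨⟨(2*(m+3)+1-i)/2, by omega⟩, by simp only [E]; split_ifs <;> omega⟩
    · have := succ_val k
      generalize k + 1 = l at *
      refine ⟨min (C (m+3) l) (min (E (m+3) k) (E (m+3) l)),
        triple _ _ _ _ fun c => ?_⟩
      simp only [E, C]; split_ifs <;> omega
  · rintro t ⟨cv, ce, h⟩
    rw [main_iff _ _ _ (fun k => ce s(k, k+1)) (fun k => rfl)] at h
    obtain ⟨_, h2, _, h4, h5, h6, h7⟩ := h
    exact upper t cv _ h2 h4 h5 h6 h7
end
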